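/- arXiv:2202.02793 — 2 statements merged into one kernel-verified Lean document; each statement's English description precedes it below -/
import Mathlib

section
/- If q^8 ≠ 1, then U_q^+(A_N) is a solvable polynomial algebra. Precisely: the family of ordered monomials (m_α), indexed by the finitely supported functions α : Λ_N → ℕ, is a K-basis of U_q^+(A_N), and there exists a monomial order ≺ on the finitely supported functions Λ_N → ℕ such that for all α, β there are a nonzero scalar c_{α,β} ∈ K and an element f_{α,β} lying in the K-span of { m_γ : γ ≺ α + β } with m_α · m_β = c_{α,β} · m_{α+β} + f_{α,β}. -/
/-- The index set Λ_N = {(i,j) : 1 ≤ i < j ≤ N+1}. -/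
def Lam (N : ℕ) : Type := {p : ℕ × ℕ // 1 ≤ p.1 ∧ p.1 < p.2 ∧ p.2 ≤ N + 1}

/-- Lexicographic linear order on Λ_N: (l,k) < (i,j) iff l < i, or l = i and k < j. -/
instance (N : ℕ) : LinearOrder (Lam N) :=
  LinearOrder.lift' (fun p => toLex p.val) (fun a b h => Subtype.ext (toLex.injective h))

/-- The Jimbo relations defining U_q^+(A_N): here `a = (i,j)` and `b = (m,n)`. -/
inductive JimboRel (K : Type) [Field K] (q : K) (N : ℕ) :
    FreeAlgebra K (Lam N) → FreeAlgebra K (Lam N) → Prop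
  /-- C1 : i = m < j < n -/
  | c1 : ∀ a b : Lam N, a.1.1 = b.1.1 → a.1.2 < b.1.2 →
      JimboRel K q N (FreeAlgebra.ι K b * FreeAlgebra.ι K a)
        ((q ^ 2)⁻¹ • (FreeAlgebra.ι K a * FreeAlgebra.ι K b))
  /-- C3 : i < m < j = n -/
  | c3 : ∀ a b : Lam N, a.1.1 < b.1.1 → a.1.2 = b.1.2 →
      JimboRel K q N (FreeAlgebra.ι K b * FreeAlgebra.ι K a)
        ((q ^ 2)⁻¹ • (FreeAlgebra.ι K a * FreeAlgebra.ι K b))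
  /-- C2 : i < m < n < j -/
  | c2 : ∀ a b : Lam N, a.1.1 < b.1.1 → b.1.2 < a.1.2 →
      JimboRel K q N (FreeAlgebra.ι K b * FreeAlgebra.ι K a)
        (FreeAlgebra.ι K a * FreeAlgebra.ι K b)
  /-- C6 : i < j < m < n -/
  | c6 : ∀ a b : Lam N, a.1.2 < b.1.1 →
      JimboRel K q N (FreeAlgebra.ι K b * FreeAlgebra.ι K a)
        (FreeAlgebra.ι K a * FreeAlgebra.ι K b)
  /-- C4 : i < m < j < n, with c = (i,n) and d = (m,j) -/
  | c4 : ∀ a b c d : Lam N, a.1.1 < b.1.1 → b.1.1 < a.1.2 → a.1.2 < b.1.2 →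
      c.1 = (a.1.1, b.1.2) → d.1 = (b.1.1, a.1.2) →
      JimboRel K q N (FreeAlgebra.ι K b * FreeAlgebra.ι K a)
        (FreeAlgebra.ι K a * FreeAlgebra.ι K b
          - (q ^ 2 - (q ^ 2)⁻¹) • (FreeAlgebra.ι K c * FreeAlgebra.ι K d))
  /-- C5 : i < j = m < n, with c = (i,n) -/
  | c5 : ∀ a b c : Lam N, a.1.2 = b.1.1 → c.1 = (a.1.1, b.1.2) →
      JimboRel K q N (FreeAlgebra.ι K b * FreeAlgebra.ι K a)
        ((q ^ 2) • (FreeAlgebra.ι K a * FreeAlgebra.ι K b) - q • FreeAlgebra.ι K c)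

/-- U_q^+(A_N): the free algebra on the X_{ij} modulo the Jimbo relations. -/
abbrev UqPlus (K : Type) [Field K] (q : K) (N : ℕ) := RingQuot (JimboRel K q N)

/-- x_{ij}: the image of the generator X_{ij} in U_q^+(A_N). -/
noncomputable def xg (K : Type) [Field K] (q : K) (N : ℕ) (p : Lam N) : UqPlus K q N :=
  RingQuot.mkAlgHom K (JimboRel K q N) (FreeAlgebra.ι K p)

/-- The ordered monomial m_α = ∏ x_{ij}^{α(i,j)}, the product taken in <_lex-increasing order. -/
noncomputable def mon (K : Type) [Field K] (q : K) (N : ℕ) (α : Lam N →₀ ℕ) : UqPlus K q N :=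
  ((α.support.sort (· ≤ ·)).map (fun p => xg K q N p ^ α p)).prod

/-- A monomial order on the finitely supported functions σ → ℕ: a well-founded strict
total order for which 0 is minimal and which is translation invariant. -/
def IsMonomialOrder (σ : Type) (r : (σ →₀ ℕ) → (σ →₀ ℕ) → Prop) : Prop :=
  WellFounded r ∧ (∀ α, ¬ r α α) ∧ (∀ α β γ, r α β → r β γ → r α γ) ∧
  (∀ α β, α ≠ β → r α β ∨ r β α) ∧ (∀ α, α ≠ 0 → r 0 α) ∧
  (∀ α β γ, r α β → r (α + γ) (β + γ))

/-- The relations between the entries of a matrix over a quantum matrix algebra. -/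
structure IsQMatrix {K C : Type*} [Field K] [Ring C] [Algebra K C] (p : K) (t : ℤ → ℤ → C) :
    Prop where
  row : ∀ i j n, j < n → t i n * t i j = p⁻¹ • (t i j * t i n)
  col : ∀ i m n, i < m → t m n * t i n = p⁻¹ • (t i n * t m n)
  anti : ∀ i m j n, i < m → j < n → t m j * t i n = t i n * t m j
  cross : ∀ i m j n, i < m → j < n →
    t m n * t i j = t i j * t m n - (p - p⁻¹) • (t i n * t m j)

/-- The relations between the diagonal entries `d j` and superdiagonal entries `v j` (in column `j`)
of a bidiagonal matrix over a quantum torus. -/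
structure IsQBidiagonal {K C : Type*} [Field K] [Ring C] [Algebra K C] (p : K) (d v : ℤ → C) :
    Prop where
  diag_comm : ∀ j k, d j * d k = d k * d j
  super_comm : ∀ j k, v j * v k = v k * v j
  comm : ∀ j k, k ≠ j → k + 1 ≠ j → d k * v j = v j * d k
  diag_super : ∀ k, d k * v k = p⁻¹ • (v k * d k)
  super_diag : ∀ k, v (k + 1) * d k = p⁻¹ • (d k * v (k + 1))

theorem IsQMatrix.mul_bidiagonal {K C : Type*} [Field K] [Ring C] [Algebra K C] {p : K}
    (hp : p ≠ 0) {t : ℤ → ℤ → C} {d v : ℤ → C} (ht : IsQMatrix p t) (hL : IsQBidiagonal p d v)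
    (hd : ∀ i j k, Commute (t i j) (d k)) (hv : ∀ i j k, Commute (t i j) (v k)) :
    IsQMatrix p (fun i j => t i j * d j + t i (j - 1) * v j) := by
  have expand : ∀ a b a' b' j n, (t a b * d n + t a (b - 1) * v n) *
      (t a' b' * d j + t a' (b' - 1) * v j) =
      (t a b * t a' b') * (d n * d j) + (t a b * t a' (b' - 1)) * (d n * v j)
      + (t a (b - 1) * t a' b') * (v n * d j)
      + (t a (b - 1) * t a' (b' - 1)) * (v n * v j) := by
    intro a b a' b' j n
    rw [add_mul, mul_add, mul_add, (hd _ _ _).symm.mul_mul_mul_comm,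
      (hd _ _ _).symm.mul_mul_mul_comm, (hv _ _ _).symm.mul_mul_mul_comm,
      (hv _ _ _).symm.mul_mul_mul_comm]
    abel
  refine ⟨?_, ?_, ?_, ?_⟩
  · intro i j n hjn
    simp only [expand]
    rw [hL.diag_comm n j, hL.super_comm n j, ht.row i j n hjn,
      ht.row i (j - 1) n (by omega), ht.row i (j - 1) (n - 1) (by omega),
      hL.comm j n (by omega) (by omega)]
    rcases eq_or_ne n (j + 1) with rfl | hne
    · rw [hL.super_diag, add_sub_cancel_right]
      simp only [smul_mul_assoc, mul_smul_comm]
      module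
    · rw [ht.row i j (n - 1) (by omega), hL.comm n j (by omega) (by omega)]
      simp only [smul_mul_assoc]
      module
  · intro i m n him
    simp only [expand]
    rw [ht.col i m n him, ht.col i m (n - 1) him, ht.cross i m (n - 1) n him (by omega),
      ht.anti i m (n - 1) n him (by omega), hL.diag_super]
    simp only [smul_mul_assoc, mul_smul_comm, sub_mul]
    match_scalars <;> field_simp
    ring
  · intro i m j n him hjn
    simp only [expand]
    rw [hL.diag_comm n j, hL.super_comm n j, ht.anti i m j n him hjn,
      ht.anti i m (j - 1) n him (by omega), ht.anti i m (j - 1) (n - 1) him (by omega),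
      hL.comm j n (by omega) (by omega)]
    rcases eq_or_ne n (j + 1) with rfl | hne
    · rw [hL.super_diag, add_sub_cancel_right, ht.col i m j him]
      simp only [smul_mul_assoc, mul_smul_comm]
      module
    · rw [ht.anti i m j (n - 1) him (by omega), hL.comm n j (by omega) (by omega)]
      module
  · intro i m j n him hjn
    simp only [expand]
    rw [hL.diag_comm n j, hL.super_comm n j, ht.cross i m j n him hjn,
      ht.cross i m (j - 1) n him (by omega), ht.cross i m (j - 1) (n - 1) him (by omega),
      hL.comm j n (by omega) (by omega)]
    rcases eq_or_ne n (j + 1) with rfl | hne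
    · rw [hL.super_diag, add_sub_cancel_right, ht.col i m j him]
      simp only [smul_mul_assoc, mul_smul_comm, sub_mul]
      match_scalars <;> field_simp
      ring
    · rw [ht.cross i m j (n - 1) him (by omega), hL.comm n j (by omega) (by omega)]
      simp only [smul_mul_assoc, sub_mul]
      module

theorem isQMatrix_one {K C : Type*} [Field K] [Ring C] [Algebra K C] (p : K) :
    IsQMatrix p (fun i j : ℤ => if i = j then (1 : C) else 0) := by
  refine ⟨?_, ?_, ?_, ?_⟩ <;> intros <;> split_ifs <;> first | omega | simp

/-- The entries `t i j * (t j j)⁻¹` of an upper triangular q-matrix satisfy the Jimbo relations. -/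
theorem IsQMatrix.normalised_rel {K C : Type*} [Field K] [Ring C] [Algebra K C] {p : K}
    (hp : p ≠ 0) {t : ℤ → ℤ → C} {e : ℤ → C} (ht : IsQMatrix p t)
    (h0 : ∀ i j, j < i → t i j = 0) (he : ∀ j, t j j * e j = 1) (he' : ∀ j, e j * t j j = 1)
    (hc : ∀ j k, e j * e k = e k * e j) :
    (∀ i j n, i < j → j < n → (t i n * e n) * (t i j * e j) =
      p⁻¹ • ((t i j * e j) * (t i n * e n))) ∧
    (∀ i m n, i < m → m < n → (t m n * e n) * (t i n * e n) =
      p⁻¹ • ((t i n * e n) * (t m n * e n))) ∧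
    (∀ i m n j, i < m → m < n → n < j →
      (t m n * e n) * (t i j * e j) = (t i j * e j) * (t m n * e n)) ∧
    (∀ i j m n, i < j → j < m → m < n →
      (t m n * e n) * (t i j * e j) = (t i j * e j) * (t m n * e n)) ∧
    (∀ i m j n, i < m → m < j → j < n → (t m n * e n) * (t i j * e j) =
      (t i j * e j) * (t m n * e n) - (p - p⁻¹) • ((t i n * e n) * (t m j * e j))) ∧
    (∀ i j n, i < j → j < n → (t j n * e n) * (t i j * e j) =
      p • ((t i j * e j) * (t j n * e n)) - (p - p⁻¹) • (t i n * e n)) := by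
  have conj : ∀ j (x : C) (a : K), t j j * x = a • (x * t j j) → x * e j = a • (e j * x) := by
    intro j x a h
    calc x * e j = e j * (t j j * x) * e j := by rw [← mul_assoc, he', one_mul]
      _ = a • (e j * x) := by
        rw [h, mul_smul_comm, smul_mul_assoc, mul_assoc, mul_assoc, he, mul_one]
  have mid : ∀ j i n, i < j → j < n → e j * t i n = t i n * e j := by
    intro j i n hij hjn
    rw [conj j (t i n) 1 (by rw [one_smul, ht.anti i j j n hij hjn]), one_smul]
  have below : ∀ j i n, i < n → n < j → e j * t i n = t i n * e j := by
    intro j i n hin hnj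
    rw [conj j (t i n) 1 (by
      rw [one_smul, ht.cross i j n j (by omega) hnj, h0 j n hnj]; simp), one_smul]
  have above : ∀ j i n, j < i → i < n → e j * t i n = t i n * e j := by
    intro j i n hji hin
    rw [conj j (t i n) 1 (by
      rw [one_smul, ht.cross j i j n hji (by omega), h0 i j hji]; simp), one_smul]
  have bot : ∀ i n, i < n → t i n * e n = p⁻¹ • (e n * t i n) := fun i n h =>
    conj n (t i n) p⁻¹ (ht.col i n n h)
  have left : ∀ i n, i < n → t i n * e i = p • (e i * t i n) := fun i n h =>
    conj i (t i n) p (by rw [ht.row i i n h, smul_smul, mul_inv_cancel₀ hp, one_smul])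
  have swap : ∀ a b x y, e x * b = b * e x → (a * e x) * (b * e y) = (a * b) * (e x * e y) := by
    intro a b x y h
    exact Commute.mul_mul_mul_comm h a (e y)
  refine ⟨?_, ?_, ?_, ?_, ?_, ?_⟩
  · intro i j n hij hjn
    rw [swap _ _ _ _ (below _ _ _ hij hjn), swap _ _ _ _ (mid _ _ _ hij hjn), ht.row i j n hjn,
      hc n j, smul_mul_assoc]
  · intro i m n him hmn
    have slide : ∀ a k, k < n → (a * e n) * (t k n * e n) = p • ((a * t k n) * (e n * e n)) := by
      intro a k hk
      have h : e n * t k n = p • (t k n * e n) := by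
        rw [bot k n hk, smul_smul, mul_inv_cancel₀ hp, one_smul]
      rw [mul_assoc, ← mul_assoc (e n), h]
      simp only [smul_mul_assoc, mul_smul_comm, ← mul_assoc]
    rw [slide _ _ (him.trans hmn), slide _ _ hmn, ht.col i m n him, smul_mul_assoc, smul_comm]
  · intro i m n j him hmn hnj
    rw [swap _ _ _ _ (mid _ _ _ (by omega) hnj), swap _ _ _ _ (below _ _ _ hmn hnj),
      ht.anti i m n j him hnj, hc n j]
  · intro i j m n hij hjm hmn
    rw [swap _ _ _ _ (below _ _ _ hij (by omega)), swap _ _ _ _ (above _ _ _ hjm hmn),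
      ht.cross i m j n (by omega) (by omega), h0 m j hjm, hc n j]
    simp
  · intro i m j n him hmj hjn
    rw [swap _ _ _ _ (below _ _ _ (by omega) hjn), swap _ _ _ _ (mid _ _ _ hmj hjn),
      swap _ _ _ _ (below _ _ _ hmj hjn), ht.cross i m j n him hjn, hc n j, sub_mul,
      smul_mul_assoc]
  · intro i j n hij hjn
    have h1 : (t i j * e j) * (t j n * e n) = p⁻¹ • ((t i j * t j n) * (e j * e n)) := by
      have h2 : e j * t j n = p⁻¹ • (t j n * e j) := by
        rw [left j n hjn, smul_smul, inv_mul_cancel₀ hp, one_smul]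
      rw [mul_assoc, ← mul_assoc (e j), h2]
      simp only [smul_mul_assoc, mul_smul_comm, ← mul_assoc]
    rw [swap _ _ _ _ (below _ _ _ hij hjn), h1, ht.cross i j j n hij hjn, hc n j, smul_smul,
      mul_inv_cancel₀ hp, one_smul, sub_mul, smul_mul_assoc, mul_assoc (t i n), ← mul_assoc (t j j),
      he, one_mul]
section
open MvPolynomial

/-- The polynomials all of whose monomials have weight at least `n`. -/
noncomputable def weightGE {σ : Type*} (K : Type*) [Field K] (w : σ → ℕ) (n : ℕ) :
    Submodule K (MvPolynomial σ K) :=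
  Submodule.span K {f | ∃ β : σ →₀ ℕ, n ≤ Finsupp.weight w β ∧ f = monomial β 1}

theorem coeff_eq_zero_of_mem_weightGE {σ K : Type*} [Field K] {w : σ → ℕ} {n : ℕ}
    {f : MvPolynomial σ K} (hf : f ∈ weightGE K w n) {β : σ →₀ ℕ} (hβ : Finsupp.weight w β < n) :
    coeff β f = 0 := by
  classical
  induction hf using Submodule.span_induction with
  | mem x h =>
    obtain ⟨γ, hγ, rfl⟩ := h
    rw [coeff_monomial, if_neg]
    rintro rfl
    omega
  | zero => simp
  | add x y _ _ hx hy => simp [hx, hy]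
  | smul a x _ hx => simp [hx]

theorem weightGE_antitone {σ K : Type*} [Field K] {w : σ → ℕ} {m n : ℕ} (h : m ≤ n) :
    weightGE K w n ≤ weightGE K w m :=
  Submodule.span_mono fun _ ⟨β, hβ, e⟩ => ⟨β, h.trans hβ, e⟩

theorem monomial_mem_weightGE {σ K : Type*} [Field K] {w : σ → ℕ} {n : ℕ} {β : σ →₀ ℕ}
    (h : n ≤ Finsupp.weight w β) (c : K) : monomial β c ∈ weightGE K w n := by
  rw [← mul_one c, ← smul_eq_mul, ← smul_monomial]
  exact Submodule.smul_mem _ _ (Submodule.subset_span ⟨β, h, rfl⟩)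

/-- `P` shifts exponents by `e`, up to a nonzero scalar and terms of higher weight. -/
def HasLead {σ K : Type*} [Field K] (w : σ → ℕ) (P : Module.End K (MvPolynomial σ K))
    (e : σ →₀ ℕ) : Prop :=
  ∀ β : σ →₀ ℕ, ∃ c : K, c ≠ 0 ∧
    P (monomial β 1) - monomial (β + e) c ∈ weightGE K w (Finsupp.weight w (β + e) + 1)

theorem HasLead.map_mem {σ K : Type*} [Field K] {w : σ → ℕ} {P : Module.End K (MvPolynomial σ K)}
    {e : σ →₀ ℕ} (h : HasLead w P e) {n : ℕ} {f : MvPolynomial σ K} (hf : f ∈ weightGE K w n) :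
    P f ∈ weightGE K w (n + Finsupp.weight w e) := by
  induction hf using Submodule.span_induction with
  | mem x hx =>
    obtain ⟨β, hβ, rfl⟩ := hx
    obtain ⟨c, -, hc⟩ := h β
    rw [map_add] at hc
    rw [← sub_add_cancel (P _) (monomial (β + e) c)]
    refine Submodule.add_mem _ (weightGE_antitone (by omega) hc) (monomial_mem_weightGE ?_ c)
    rw [map_add]
    omega
  | zero => simp
  | add x y _ _ hx hy => simpa using Submodule.add_mem _ hx hy
  | smul a x _ hx => simpa using Submodule.smul_mem _ a hx

theorem HasLead.mul {σ K : Type*} [Field K] {w : σ → ℕ} {P Q : Module.End K (MvPolynomial σ K)}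
    {e e' : σ →₀ ℕ} (hP : HasLead w P e) (hQ : HasLead w Q e') : HasLead w (P * Q) (e' + e) := by
  intro β
  obtain ⟨c, hc0, hc⟩ := hQ β
  obtain ⟨c', hc0', hc'⟩ := hP (β + e')
  refine ⟨c * c', mul_ne_zero hc0 hc0', ?_⟩
  have key : (P * Q) (monomial β 1) - monomial (β + (e' + e)) (c * c') =
      P (Q (monomial β 1) - monomial (β + e') c) +
        c • (P (monomial (β + e') 1) - monomial (β + e' + e) c') := by
    have h1 : monomial (β + e') c = c • (monomial (β + e') 1 : MvPolynomial σ K) := by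
      rw [smul_monomial, smul_eq_mul, mul_one]
    rw [h1, map_sub, map_smul, smul_sub, smul_monomial, smul_eq_mul, add_assoc,
      Module.End.mul_apply]
    abel
  rw [key]
  refine Submodule.add_mem _ (weightGE_antitone ?_ (hP.map_mem hc))
    (Submodule.smul_mem _ _ (weightGE_antitone ?_ hc'))
  · simp only [map_add]; omega
  · simp only [map_add]; omega

theorem HasLead.add {σ K : Type*} [Field K] {w : σ → ℕ} {P Q : Module.End K (MvPolynomial σ K)}
    {e e' : σ →₀ ℕ} (hP : HasLead w P e) (hQ : HasLead w Q e')
    (h : Finsupp.weight w e < Finsupp.weight w e') : HasLead w (P + Q) e := by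
  intro β
  obtain ⟨c, hc0, hc⟩ := hP β
  refine ⟨c, hc0, ?_⟩
  rw [LinearMap.add_apply, add_sub_right_comm]
  refine Submodule.add_mem _ hc (weightGE_antitone ?_
    (hQ.map_mem (monomial_mem_weightGE le_rfl 1)))
  simp only [map_add]; omega

theorem HasLead.smul {σ K : Type*} [Field K] {w : σ → ℕ} {P : Module.End K (MvPolynomial σ K)}
    {e : σ →₀ ℕ} (hP : HasLead w P e) {a : K} (ha : a ≠ 0) : HasLead w (a • P) e := by
  intro β
  obtain ⟨c, hc0, hc⟩ := hP β
  refine ⟨a * c, mul_ne_zero ha hc0, ?_⟩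
  rw [LinearMap.smul_apply, ← smul_eq_mul, ← smul_monomial, ← smul_sub]
  exact Submodule.smul_mem _ _ hc

theorem HasLead.one {σ K : Type*} [Field K] (w : σ → ℕ) :
    HasLead w (1 : Module.End K (MvPolynomial σ K)) 0 :=
  fun β => ⟨1, one_ne_zero, by simp⟩

theorem HasLead.list_prod {σ K ι : Type*} [Field K] {w : σ → ℕ}
    {P : ι → Module.End K (MvPolynomial σ K)} {e : ι → σ →₀ ℕ} (h : ∀ i, HasLead w (P i) (e i))
    (l : List ι) : HasLead w (l.map P).prod (l.map e).sum := by
  induction l with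
  | nil => simpa using HasLead.one w
  | cons a l ih =>
    rw [List.map_cons, List.map_cons, List.prod_cons, List.sum_cons, add_comm]
    exact (h a).mul ih

/-- Polynomials with distinct lowest-weight terms are linearly independent. -/
theorem linearIndependent_of_lead {σ K ι : Type*} [Field K] {w : σ → ℕ}
    {f : ι → MvPolynomial σ K} {e : ι → σ →₀ ℕ} (he : Function.Injective e)
    (h : ∀ i, ∃ c : K, c ≠ 0 ∧
      f i - monomial (e i) c ∈ weightGE K w (Finsupp.weight w (e i) + 1)) :
    LinearIndependent K f := by
  classical
  choose c hc0 hc using h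
  rw [linearIndependent_iff]
  intro l hl
  by_contra hne
  obtain ⟨i, hi, hmin⟩ := l.support.exists_min_image (fun i => Finsupp.weight w (e i))
    (Finsupp.support_nonempty_iff.2 hne)
  have hcoeff : ∀ j ∈ l.support, coeff (e i) (f j) = if j = i then c i else 0 := by
    intro j hj
    have h1 := coeff_eq_zero_of_mem_weightGE (hc j) (Nat.lt_succ_of_le (hmin j hj))
    rw [coeff_sub, sub_eq_zero, coeff_monomial] at h1
    rw [h1]
    by_cases hji : j = i
    · simp [hji]
    · rw [if_neg hji, if_neg (fun h => hji (he h))]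
  have h2 := congrArg (coeff (e i)) hl
  rw [Finsupp.linearCombination_apply, Finsupp.sum, coeff_sum, coeff_zero,
    Finset.sum_congr rfl (g := fun j => if j = i then l i * c i else 0), Finset.sum_ite_eq',
    if_pos hi] at h2
  · exact mul_ne_zero (Finsupp.mem_support_iff.1 hi) (hc0 i) h2
  · intro j hj
    rw [coeff_smul, hcoeff j hj, smul_eq_mul]
    split_ifs with hji
    · rw [hji]
    · rw [mul_zero]

/-- The algebra endomorphism rescaling each variable `X v` by `c v`. -/
noncomputable def rescale {σ K : Type*} [Field K] (c : σ → K) : Module.End K (MvPolynomial σ K) :=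
  (aeval (fun v => C (c v) * X v) : MvPolynomial σ K →ₐ[K] MvPolynomial σ K).toLinearMap

/-- Multiplication by the variable `X v`. -/
noncomputable def mulVar {σ : Type*} (K : Type*) [Field K] (v : σ) :
    Module.End K (MvPolynomial σ K) :=
  LinearMap.mulLeft K (X v)

theorem rescale_mul {σ K : Type*} [Field K] (c c' : σ → K) :
    rescale c * rescale c' = rescale (c * c') := by
  have h : (aeval (fun v => C (c v) * X v) : MvPolynomial σ K →ₐ[K] MvPolynomial σ K).comp
      (aeval (fun v => C (c' v) * X v)) = aeval (fun v => C ((c * c') v) * X v) := by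
    apply MvPolynomial.algHom_ext
    intro v
    simp only [AlgHom.comp_apply, aeval_X, map_mul, algHom_C, Pi.mul_apply, algebraMap_eq]
    ring
  exact congrArg AlgHom.toLinearMap h

theorem rescale_one {σ K : Type*} [Field K] : rescale (1 : σ → K) = 1 := by
  have h : (aeval (fun v => C ((1 : σ → K) v) * X v) : MvPolynomial σ K →ₐ[K] MvPolynomial σ K) =
      AlgHom.id K _ := by
    apply MvPolynomial.algHom_ext
    intro v
    simp
  exact congrArg AlgHom.toLinearMap h

theorem rescale_mul_mulVar {σ K : Type*} [Field K] (c : σ → K) (v : σ) :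
    rescale c * mulVar K v = c v • (mulVar K v * rescale c) := by
  refine LinearMap.ext fun f => ?_
  simp [rescale, mulVar, smul_eq_C_mul, mul_assoc]

theorem mulVar_comm {σ K : Type*} [Field K] (u v : σ) :
    mulVar K u * mulVar K v = mulVar K v * mulVar K u := by
  refine LinearMap.ext fun f => ?_
  simp [mulVar, mul_left_comm]

theorem hasLead_mulVar {σ K : Type*} [Field K] (w : σ → ℕ) (v : σ) :
    HasLead w (mulVar K v) (Finsupp.single v 1) := by
  intro β
  refine ⟨1, one_ne_zero, ?_⟩
  simp [mulVar, X, monomial_mul, add_comm]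

theorem hasLead_rescale {σ K : Type*} [Field K] (w : σ → ℕ) {c : σ → K} (hc : ∀ v, c v ≠ 0) :
    HasLead w (rescale c) 0 := by
  intro β
  refine ⟨β.prod fun v n => c v ^ n, Finset.prod_ne_zero_iff.2 fun v _ => pow_ne_zero _ (hc v), ?_⟩
  have : rescale c (monomial β 1) = monomial β (β.prod fun v n => c v ^ n) := by
    simp only [rescale, AlgHom.toLinearMap_apply, aeval_monomial, map_one, one_mul, mul_pow,
      Finsupp.prod_mul]
    rw [monomial_eq, Finsupp.prod, Finsupp.prod, Finsupp.prod, map_prod]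
    simp
  simp [this]

/-- The diagonal entries of the bidiagonal matrix of level `s`. -/
noncomputable def levelDiag {K : Type*} [Field K] (p : K) (s : ℕ) (k : ℤ) :
    Module.End K (MvPolynomial (ℤ × ℕ) K) :=
  rescale fun v => if v = (k, s) then p⁻¹ else if v = (k + 1, s) then p else 1

theorem rescale_comm {σ K : Type*} [Field K] (c c' : σ → K) :
    rescale c * rescale c' = rescale c' * rescale c := by
  rw [rescale_mul, rescale_mul, mul_comm]

theorem levelDiag_mul_mulVar {K : Type*} [Field K] (p : K) (s : ℕ) (k : ℤ) {v : ℤ × ℕ}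
    (h : v ≠ (k, s)) (h' : v ≠ (k + 1, s)) :
    levelDiag p s k * mulVar K v = mulVar K v * levelDiag p s k := by
  rw [levelDiag, rescale_mul_mulVar, if_neg h, if_neg h', one_smul]

theorem isQBidiagonal_level {K : Type*} [Field K] {p : K} (hp : p ≠ 0) (s : ℕ) :
    IsQBidiagonal p (levelDiag p s) (fun k => mulVar K (k, s)) where
  diag_comm _ _ := rescale_comm _ _
  super_comm _ _ := mulVar_comm _ _
  comm j k h h' := levelDiag_mul_mulVar p s k (by simpa using h.symm) (by simpa using h'.symm)
  diag_super k := by rw [levelDiag, rescale_mul_mulVar, if_pos rfl]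
  super_diag k := by
    rw [levelDiag, rescale_mul_mulVar, if_neg (by simp), if_pos rfl, smul_smul,
      inv_mul_cancel₀ hp, one_smul]

/-- The product of the bidiagonal matrices of levels `0, …, s - 1`. -/
noncomputable def tower {K : Type*} [Field K] (p : K) :
    ℕ → ℤ → ℤ → Module.End K (MvPolynomial (ℤ × ℕ) K)
  | 0 => fun i j => if i = j then 1 else 0
  | s + 1 => fun i j => tower p s i j * levelDiag p s j + tower p s i (j - 1) * mulVar K (j, s)

theorem tower_zero {K : Type*} [Field K] (p : K) (i j : ℤ) :
    tower p 0 i j = if i = j then 1 else 0 := rfl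

theorem tower_succ {K : Type*} [Field K] (p : K) (s : ℕ) (i j : ℤ) :
    tower p (s + 1) i j =
      tower p s i j * levelDiag p s j + tower p s i (j - 1) * mulVar K (j, s) := rfl

theorem tower_commute {K : Type*} [Field K] (p : K) {s : ℕ}
    {x : Module.End K (MvPolynomial (ℤ × ℕ) K)}
    (hx : ∀ r < s, ∀ k, Commute (levelDiag p r k) x ∧ Commute (mulVar K (k, r)) x) (i j : ℤ) :
    Commute (tower p s i j) x := by
  induction s generalizing j with
  | zero =>
    rw [tower_zero]
    split_ifs
    · exact Commute.one_left x
    · exact Commute.zero_left x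
  | succ s ih =>
    have ih' := ih fun r hr => hx r (hr.trans s.lt_succ_self)
    exact ((ih' j).mul_left (hx s s.lt_succ_self j).1).add_left
      ((ih' (j - 1)).mul_left (hx s s.lt_succ_self j).2)

theorem isQMatrix_tower {K : Type*} [Field K] {p : K} (hp : p ≠ 0) (s : ℕ) :
    IsQMatrix p (tower p s) := by
  induction s with
  | zero => exact isQMatrix_one p
  | succ s ih =>
    refine ih.mul_bidiagonal hp (isQBidiagonal_level hp s) ?_ ?_
    · exact fun i j k => tower_commute p (fun r hr l => ⟨rescale_comm _ _,
        (levelDiag_mul_mulVar p s k (by simp [hr.ne]) (by simp [hr.ne])).symm⟩) i j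
    · exact fun i j k => tower_commute p (fun r hr l => ⟨
        levelDiag_mul_mulVar p r l (by simp [hr.ne']) (by simp [hr.ne']), mulVar_comm _ _⟩) i j

theorem tower_eq_zero_of_lt {K : Type*} [Field K] (p : K) (s : ℕ) {i j : ℤ} (h : j < i) :
    tower p s i j = 0 := by
  induction s generalizing j with
  | zero => rw [tower_zero, if_neg h.ne']
  | succ s ih => rw [tower_succ, ih h, ih (by omega), zero_mul, zero_mul, add_zero]

theorem tower_eq_zero_of_gt {K : Type*} [Field K] (p : K) (s : ℕ) {i j : ℤ} (h : i + s < j) :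
    tower p s i j = 0 := by
  induction s generalizing j with
  | zero => rw [tower_zero, if_neg (by push_cast at h; omega)]
  | succ s ih =>
    rw [tower_succ, ih (by push_cast at h; omega), ih (by push_cast at h; omega), zero_mul,
      zero_mul, add_zero]

theorem exists_tower_diag {K : Type*} [Field K] {p : K} (hp : p ≠ 0) (s : ℕ) (j : ℤ) :
    ∃ c : ℤ × ℕ → K, (∀ v, c v ≠ 0) ∧ tower p s j j = rescale c := by
  induction s with
  | zero => exact ⟨1, fun v => one_ne_zero, by rw [tower_zero, if_pos rfl, rescale_one]⟩
  | succ s ih =>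
    obtain ⟨c, hc, h⟩ := ih
    refine ⟨c * _, fun v => mul_ne_zero (hc v) ?_, by
      rw [tower_succ, h, tower_eq_zero_of_lt p s (sub_one_lt j), zero_mul, add_zero, levelDiag,
        rescale_mul]⟩
    split_ifs
    · exact inv_ne_zero hp
    · exact hp
    · exact one_ne_zero

theorem hasLead_levelDiag {K : Type*} [Field K] {p : K} (hp : p ≠ 0) (w : ℤ × ℕ → ℕ) (s : ℕ)
    (k : ℤ) : HasLead w (levelDiag p s k) 0 := by
  refine hasLead_rescale w fun v => ?_
  split_ifs
  · exact inv_ne_zero hp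
  · exact hp
  · exact one_ne_zero

/-- The exponent of the lowest-weight path from `i` to `i + n`. -/
noncomputable def pathExp (i : ℤ) (n : ℕ) : ℤ × ℕ →₀ ℕ :=
  ∑ r ∈ Finset.range n, Finsupp.single (i + r + 1, r) 1

theorem pathExp_succ (i : ℤ) (n : ℕ) :
    pathExp i (n + 1) = pathExp i n + Finsupp.single (i + n + 1, n) 1 :=
  Finset.sum_range_succ _ _

theorem pathExp_apply (i : ℤ) (n : ℕ) (k : ℤ) (r : ℕ) :
    pathExp i n (k, r) = if r < n ∧ k = i + r + 1 then 1 else 0 := by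
  induction n with
  | zero => simp [pathExp]
  | succ n ih =>
    rw [pathExp_succ, Finsupp.add_apply, ih, Finsupp.single_apply]
    simp only [Prod.mk.injEq]
    split_ifs <;> omega

theorem hasLead_tower {K : Type*} [Field K] {p : K} (hp : p ≠ 0) {s n : ℕ} (h : n ≤ s) (i : ℤ) :
    HasLead Prod.snd (tower p s i (i + n)) (pathExp i n) := by
  induction s generalizing n with
  | zero =>
    obtain rfl : n = 0 := by omega
    simpa [tower_zero, pathExp] using HasLead.one _
  | succ s ih =>
    have hdiag : n ≤ s → HasLead Prod.snd (tower p s i (i + n) * levelDiag p s (i + n))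
        (pathExp i n) := fun hn => by
      simpa using (ih hn).mul (hasLead_levelDiag hp Prod.snd s (i + n))
    rcases n with _ | n
    · rw [tower_succ, tower_eq_zero_of_lt p s (show i + (0 : ℕ) - 1 < i by simp), zero_mul,
        add_zero]
      exact hdiag (Nat.zero_le s)
    · have hsuper := (ih (Nat.le_of_succ_le_succ h)).mul
        (hasLead_mulVar (K := K) Prod.snd (i + n + 1, s))
      have hidx : i + ((n + 1 : ℕ) : ℤ) - 1 = i + n := by push_cast; ring
      have hidx' : i + ((n + 1 : ℕ) : ℤ) = i + n + 1 := by push_cast; ring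
      rw [tower_succ, hidx]
      rcases Nat.lt_or_ge n s with hns | hns
      · refine (hdiag hns).add (hidx' ▸ hsuper) ?_
        rw [pathExp_succ, map_add, map_add, Finsupp.weight_single, Finsupp.weight_single]
        simp only [smul_eq_mul, one_mul]
        omega
      · obtain rfl : n = s := by omega
        rw [tower_eq_zero_of_gt p n (by push_cast; omega), zero_mul, zero_add, pathExp_succ,
          add_comm (pathExp i n), hidx']
        exact hsuper

end

/-- The strictly concave weight `d (2N + 2 - d)`, `d = j - i`, of the generator `x_{ij}`. -/
def rootWeight (N : ℕ) (a : Lam N) : ℕ := (a.1.2 - a.1.1) * (2 * N + 2 - (a.1.2 - a.1.1))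

/-- The product of generators along a word. -/
noncomputable def wordProd (K : Type) [Field K] (q : K) (N : ℕ) (l : List (Lam N)) : UqPlus K q N :=
  (l.map (xg K q N)).prod

/-- The weight of a word. -/
def wordWeight {N : ℕ} (l : List (Lam N)) : ℕ := (l.map (rootWeight N)).sum

/-- The span of the words of weight less than `w`. -/
def wordSpanLT (K : Type) [Field K] (q : K) (N : ℕ) (w : ℕ) : Submodule K (UqPlus K q N) :=
  Submodule.span K {x | ∃ l : List (Lam N), wordWeight l < w ∧ x = wordProd K q N l}

section
variable {K : Type} [Field K] {q : K} {N : ℕ}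

theorem wordProd_append (l l' : List (Lam N)) :
    wordProd K q N (l ++ l') = wordProd K q N l * wordProd K q N l' := by
  simp [wordProd]

theorem wordWeight_append (l l' : List (Lam N)) :
    wordWeight (l ++ l') = wordWeight l + wordWeight l' := by
  simp [wordWeight]

theorem wordWeight_perm {l l' : List (Lam N)} (h : l.Perm l') : wordWeight l = wordWeight l' :=
  (h.map _).sum_eq

theorem wordProd_mem_wordSpanLT {l : List (Lam N)} {w : ℕ} (h : wordWeight l < w) :
    wordProd K q N l ∈ wordSpanLT K q N w :=
  Submodule.subset_span ⟨l, h, rfl⟩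

theorem wordProd_mul_mem (l : List (Lam N)) {w : ℕ} {x : UqPlus K q N}
    (hx : x ∈ wordSpanLT K q N w) :
    wordProd K q N l * x ∈ wordSpanLT K q N (wordWeight l + w) := by
  induction hx using Submodule.span_induction with
  | mem x h =>
    obtain ⟨m, hm, rfl⟩ := h
    rw [← wordProd_append]
    exact wordProd_mem_wordSpanLT (by rw [wordWeight_append]; omega)
  | zero => simp
  | add x y _ _ hx hy => rw [mul_add]; exact Submodule.add_mem _ hx hy
  | smul a x _ hx => rw [mul_smul_comm]; exact Submodule.smul_mem _ a hx

theorem mul_wordProd_mem (l : List (Lam N)) {w : ℕ} {x : UqPlus K q N}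
    (hx : x ∈ wordSpanLT K q N w) :
    x * wordProd K q N l ∈ wordSpanLT K q N (w + wordWeight l) := by
  induction hx using Submodule.span_induction with
  | mem x h =>
    obtain ⟨m, hm, rfl⟩ := h
    rw [← wordProd_append]
    exact wordProd_mem_wordSpanLT (by rw [wordWeight_append]; omega)
  | zero => simp
  | add x y _ _ hx hy => rw [add_mul]; exact Submodule.add_mem _ hx hy
  | smul a x _ hx => rw [smul_mul_assoc]; exact Submodule.smul_mem _ a hx

theorem xg_mul_xg (a b : Lam N) {y : FreeAlgebra K (Lam N)}
    (h : JimboRel K q N (FreeAlgebra.ι K b * FreeAlgebra.ι K a) y) :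
    xg K q N b * xg K q N a = RingQuot.mkAlgHom K (JimboRel K q N) y := by
  rw [← RingQuot.mkAlgHom_rel K h, map_mul]
  rfl

theorem rootWeight_concave {c d x y L : ℕ} (hcx : x < c) (hcy : y < c) (hsum : c + d = x + y)
    (hL : c < L) : c * (2 * L - c) + d * (2 * L - d) < x * (2 * L - x) + y * (2 * L - y) := by
  obtain ⟨u, rfl⟩ := Nat.exists_eq_add_of_lt hcx
  obtain ⟨k, rfl⟩ := Nat.exists_eq_add_of_lt hL
  obtain rfl : y = u + 1 + d := by omega
  obtain ⟨v, rfl⟩ : ∃ v, x = d + v + 1 := ⟨x - d - 1, by omega⟩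
  zify [show d + v + 1 + u + 1 ≤ 2 * (d + v + 1 + u + 1 + k + 1) by omega,
    show d ≤ 2 * (d + v + 1 + u + 1 + k + 1) by omega,
    show u + 1 + d ≤ 2 * (d + v + 1 + u + 1 + k + 1) by omega,
    show d + v + 1 ≤ 2 * (d + v + 1 + u + 1 + k + 1) by omega]
  nlinarith [mul_nonneg (Int.natCast_nonneg u) (Int.natCast_nonneg v)]

theorem exists_wordProd_swap_of_lt (hq0 : q ≠ 0) {a b : Lam N} (hab : a < b) :
    ∃ c : K, c ≠ 0 ∧ wordProd K q N [b, a] - c • wordProd K q N [a, b] ∈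
      wordSpanLT K q N (wordWeight [a, b]) := by
  have hq2 : q ^ 2 ≠ 0 := pow_ne_zero 2 hq0
  have two : ∀ x y : Lam N, wordProd K q N [x, y] = xg K q N x * xg K q N y := by
    simp [wordProd]
  have hx : ∀ z, RingQuot.mkAlgHom K (JimboRel K q N) (FreeAlgebra.ι K z) = xg K q N z :=
    fun _ => rfl
  have hlex : a.1.1 < b.1.1 ∨ a.1.1 = b.1.1 ∧ a.1.2 < b.1.2 := Prod.Lex.toLex_lt_toLex.1 hab
  have ha := a.2
  have hb := b.2
  simp only [two]
  rcases hlex with him | ⟨him, hjn⟩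
  · rcases lt_trichotomy a.1.2 b.1.2 with hjn | hjn | hjn
    · obtain ⟨c, hc⟩ : ∃ c : Lam N, c.1 = (a.1.1, b.1.2) :=
        ⟨⟨(a.1.1, b.1.2), ha.1, by dsimp only; omega, hb.2.2⟩, rfl⟩
      rcases lt_trichotomy a.1.2 b.1.1 with hjm | hjm | hjm
      · refine ⟨1, one_ne_zero, ?_⟩
        rw [xg_mul_xg _ _ (JimboRel.c6 _ _ hjm), map_mul, hx, hx, one_smul, sub_self]
        exact zero_mem _
      · refine ⟨q ^ 2, hq2, ?_⟩
        rw [xg_mul_xg _ _ (JimboRel.c5 a b c hjm hc), map_sub,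
          map_smul, map_smul, map_mul, hx, hx, hx, sub_right_comm, sub_self, zero_sub]
        refine Submodule.neg_mem _ (Submodule.smul_mem _ _ (Submodule.subset_span ⟨[c], ?_,
          by simp [wordProd]⟩))
        have := rootWeight_concave (c := b.1.2 - a.1.1) (d := 0) (x := a.1.2 - a.1.1)
          (y := b.1.2 - b.1.1) (L := N + 1) (by omega) (by omega) (by omega) (by omega)
        simpa [wordWeight, rootWeight, mul_add, hc] using this
      · obtain ⟨d, hd⟩ : ∃ d : Lam N, d.1 = (b.1.1, a.1.2) :=
          ⟨⟨(b.1.1, a.1.2), hb.1, hjm, ha.2.2⟩, rfl⟩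
        refine ⟨1, one_ne_zero, ?_⟩
        rw [xg_mul_xg _ _ (JimboRel.c4 a b c d him hjm hjn hc hd), map_sub,
          map_smul, map_mul, map_mul, hx, hx, hx, hx, one_smul, sub_right_comm, sub_self, zero_sub]
        refine Submodule.neg_mem _ (Submodule.smul_mem _ _ (Submodule.subset_span ⟨[c, d], ?_,
          (two _ _).symm⟩))
        have := rootWeight_concave (c := b.1.2 - a.1.1) (d := a.1.2 - b.1.1) (x := a.1.2 - a.1.1)
          (y := b.1.2 - b.1.1) (L := N + 1) (by omega) (by omega) (by omega) (by omega)
        simpa [wordWeight, rootWeight, mul_add, hc, hd] using this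
    · refine ⟨(q ^ 2)⁻¹, inv_ne_zero hq2, ?_⟩
      rw [xg_mul_xg _ _ (JimboRel.c3 _ _ him hjn), map_smul, map_mul, hx, hx, sub_self]
      exact zero_mem _
    · refine ⟨1, one_ne_zero, ?_⟩
      rw [xg_mul_xg _ _ (JimboRel.c2 _ _ him hjn), map_mul, hx, hx, one_smul, sub_self]
      exact zero_mem _
  · refine ⟨(q ^ 2)⁻¹, inv_ne_zero hq2, ?_⟩
    rw [xg_mul_xg _ _ (JimboRel.c1 _ _ him hjn), map_smul, map_mul, hx, hx, sub_self]
    exact zero_mem _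

theorem exists_wordProd_swap (hq0 : q ≠ 0) (a b : Lam N) :
    ∃ c : K, c ≠ 0 ∧ wordProd K q N [b, a] - c • wordProd K q N [a, b] ∈
      wordSpanLT K q N (wordWeight [a, b]) := by
  rcases lt_trichotomy a b with h | rfl | h
  · exact exists_wordProd_swap_of_lt hq0 h
  · exact ⟨1, one_ne_zero, by simp⟩
  · obtain ⟨c, hc0, hc⟩ := exists_wordProd_swap_of_lt hq0 h
    refine ⟨c⁻¹, inv_ne_zero hc0, ?_⟩
    have := Submodule.smul_mem _ (-c⁻¹) hc
    rw [smul_sub, smul_smul, neg_mul, inv_mul_cancel₀ hc0, neg_smul, neg_smul, one_smul,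
      sub_neg_eq_add, neg_add_eq_sub] at this
    rwa [wordWeight_perm (List.Perm.swap b a [])]

theorem exists_wordProd_perm (hq0 : q ≠ 0) {l l' : List (Lam N)} (h : l.Perm l') :
    ∃ c : K, c ≠ 0 ∧ wordProd K q N l - c • wordProd K q N l' ∈
      wordSpanLT K q N (wordWeight l) := by
  induction h with
  | nil => exact ⟨1, one_ne_zero, by simp⟩
  | @cons a l l' h ih =>
    obtain ⟨c, hc0, hc⟩ := ih
    refine ⟨c, hc0, ?_⟩
    have := wordProd_mul_mem [a] hc
    rw [mul_sub, mul_smul_comm, ← wordProd_append, ← wordProd_append] at this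
    simpa [wordWeight] using this
  | swap a b l =>
    obtain ⟨c, hc0, hc⟩ := exists_wordProd_swap (q := q) hq0 a b
    refine ⟨c, hc0, ?_⟩
    have := mul_wordProd_mem l hc
    rw [sub_mul, smul_mul_assoc, ← wordProd_append, ← wordProd_append, ← wordWeight_append] at this
    rwa [wordWeight_perm (List.Perm.swap a b l)]
  | @trans l₁ l₂ l₃ h₁ h₂ ih₁ ih₂ =>
    obtain ⟨c, hc0, hc⟩ := ih₁
    obtain ⟨c', hc0', hc'⟩ := ih₂
    refine ⟨c * c', mul_ne_zero hc0 hc0', ?_⟩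
    rw [← wordWeight_perm h₁] at hc'
    have := Submodule.add_mem _ hc (Submodule.smul_mem _ c hc')
    rwa [smul_sub, smul_smul, sub_add_sub_cancel] at this

/-- The increasing word whose product is the ordered monomial `m_α`. -/
def orderedWord (α : Lam N →₀ ℕ) : List (Lam N) :=
  (α.support.sort (· ≤ ·)).flatMap fun p => List.replicate (α p) p

theorem mon_eq_wordProd (α : Lam N →₀ ℕ) : mon K q N α = wordProd K q N (orderedWord α) := by
  rw [mon, wordProd, orderedWord, List.map_flatMap, List.flatMap, List.prod_flatten, List.map_map]
  congr 1
  refine List.map_congr_left fun p _ => ?_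
  simp

theorem coe_orderedWord (α : Lam N →₀ ℕ) :
    (orderedWord α : Multiset (Lam N)) = Finsupp.toMultiset α := by
  rw [orderedWord, ← Multiset.coe_bind, Finset.sort_eq, Multiset.bind, Multiset.join,
    Finsupp.toMultiset_apply, Finsupp.sum, Finset.sum]
  congr 1
  refine Multiset.map_congr rfl fun p _ => ?_
  rw [Multiset.coe_replicate, Multiset.nsmul_singleton]

/-- The weight of an exponent. -/
noncomputable def expWeight (α : Lam N →₀ ℕ) : ℕ := wordWeight (orderedWord α)

theorem exists_orderedWord_perm (l : List (Lam N)) : ∃ α, l.Perm (orderedWord α) := by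
  refine ⟨Multiset.toFinsupp (l : Multiset (Lam N)), ?_⟩
  rw [← Multiset.coe_eq_coe, coe_orderedWord, Multiset.toFinsupp_toMultiset]

theorem orderedWord_add_perm (α β : Lam N →₀ ℕ) :
    (orderedWord α ++ orderedWord β).Perm (orderedWord (α + β)) := by
  rw [← Multiset.coe_eq_coe, ← Multiset.coe_add, coe_orderedWord, coe_orderedWord,
    coe_orderedWord, map_add]

theorem expWeight_add (α β : Lam N →₀ ℕ) : expWeight (α + β) = expWeight α + expWeight β := by
  rw [expWeight, ← wordWeight_perm (orderedWord_add_perm α β), wordWeight_append]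
  rfl

/-- The span of the ordered monomials of weight less than `w`. -/
def monSpanLT (K : Type) [Field K] (q : K) (N : ℕ) (w : ℕ) : Submodule K (UqPlus K q N) :=
  Submodule.span K {x | ∃ α : Lam N →₀ ℕ, expWeight α < w ∧ x = mon K q N α}

theorem wordSpanLT_le_monSpanLT (hq0 : q ≠ 0) (w : ℕ) : wordSpanLT K q N w ≤ monSpanLT K q N w := by
  induction w using Nat.strong_induction_on with
  | _ w ih =>
    refine Submodule.span_le.2 ?_
    rintro _ ⟨l, hl, rfl⟩
    obtain ⟨α, hα⟩ := exists_orderedWord_perm l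
    obtain ⟨c, -, hc⟩ := exists_wordProd_perm (q := q) hq0 hα
    rw [SetLike.mem_coe, ← sub_add_cancel (wordProd K q N l) (c • wordProd K q N (orderedWord α))]
    refine Submodule.add_mem _ ?_ (Submodule.smul_mem _ _ (Submodule.subset_span ⟨α, ?_, ?_⟩))
    · refine Submodule.span_mono ?_ (ih _ hl hc)
      rintro _ ⟨β, hβ, rfl⟩
      exact ⟨β, hβ.trans hl, rfl⟩
    · rwa [expWeight, ← wordWeight_perm hα]
    · rw [mon_eq_wordProd]

theorem exists_mon_mul_mon (hq0 : q ≠ 0) (α β : Lam N →₀ ℕ) :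
    ∃ c : K, c ≠ 0 ∧ mon K q N α * mon K q N β - c • mon K q N (α + β) ∈
      monSpanLT K q N (expWeight (α + β)) := by
  obtain ⟨c, hc0, hc⟩ := exists_wordProd_perm (q := q) hq0 (orderedWord_add_perm α β)
  refine ⟨c, hc0, ?_⟩
  rw [mon_eq_wordProd, mon_eq_wordProd, mon_eq_wordProd, ← wordProd_append, expWeight,
    ← wordWeight_perm (orderedWord_add_perm α β)]
  exact wordSpanLT_le_monSpanLT hq0 _ hc

theorem span_mon_eq_top (hq0 : q ≠ 0) : Submodule.span K (Set.range (mon K q N)) = ⊤ := by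
  have hword : ∀ l, wordProd K q N l ∈ Submodule.span K (Set.range (mon K q N)) := by
    intro l
    refine Submodule.span_mono ?_ (wordSpanLT_le_monSpanLT hq0 _
      (wordProd_mem_wordSpanLT (Nat.lt_succ_self (wordWeight l))))
    rintro _ ⟨α, -, rfl⟩
    exact ⟨α, rfl⟩
  have hmul : ∀ x ∈ Submodule.span K (Set.range (wordProd K q N)),
      ∀ y ∈ Submodule.span K (Set.range (wordProd K q N)),
      x * y ∈ Submodule.span K (Set.range (wordProd K q N)) := by
    intro x hx y hy
    induction hx, hy using Submodule.span_induction₂ with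
    | mem_mem x y hx hy =>
      obtain ⟨l, rfl⟩ := hx
      obtain ⟨l', rfl⟩ := hy
      exact Submodule.subset_span ⟨l ++ l', wordProd_append l l'⟩
    | zero_left => simp
    | zero_right => simp
    | add_left x y z _ _ _ hx hy => rw [add_mul]; exact Submodule.add_mem _ hx hy
    | add_right x y z _ _ _ hx hy => rw [mul_add]; exact Submodule.add_mem _ hx hy
    | smul_left r x y _ _ h => rw [smul_mul_assoc]; exact Submodule.smul_mem _ _ h
    | smul_right r x y _ _ h => rw [mul_smul_comm]; exact Submodule.smul_mem _ _ h
  rw [eq_top_iff]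
  rintro x -
  refine Submodule.span_le.2 (by rintro _ ⟨l, rfl⟩; exact hword l)
    (?_ : x ∈ Submodule.span K (Set.range (wordProd K q N)))
  obtain ⟨y, rfl⟩ := RingQuot.mkAlgHom_surjective K (JimboRel K q N) x
  induction y using FreeAlgebra.induction with
  | grade0 r =>
    rw [AlgHom.commutes, Algebra.algebraMap_eq_smul_one]
    exact Submodule.smul_mem _ _ (Submodule.subset_span ⟨[], by simp [wordProd]⟩)
  | grade1 z => exact Submodule.subset_span ⟨[z], by simp [wordProd]; rfl⟩
  | mul a b ha hb => rw [map_mul]; exact hmul _ ha _ hb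
  | add a b ha hb => rw [map_add]; exact Submodule.add_mem _ ha hb

end

instance (N : ℕ) : Finite (Lam N) :=
  Set.Finite.to_subtype (((Set.finite_Iic (N + 1)).prod (Set.finite_Iic (N + 1))).subset
    fun _ hp => ⟨(hp.2.1.trans_le hp.2.2).le, hp.2.2⟩)

/-- Comparison of exponents by weight, with ties broken lexicographically. -/
def expOrder (N : ℕ) (α β : Lam N →₀ ℕ) : Prop :=
  expWeight α < expWeight β ∨ expWeight α = expWeight β ∧ toLex α < toLex β

theorem isMonomialOrder_expOrder (N : ℕ) : IsMonomialOrder (Lam N) (expOrder N) := by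
  refine ⟨?_, ?_, ?_, ?_, ?_, ?_⟩
  · have h : WellFounded (Prod.Lex (· < · : ℕ → ℕ → Prop)
        (· < · : Lex (Lam N →₀ ℕ) → Lex (Lam N →₀ ℕ) → Prop)) :=
      WellFounded.prod_lex wellFounded_lt wellFounded_lt
    refine Subrelation.wf ?_ (InvImage.wf (fun α => (expWeight α, toLex α)) h)
    intro α β hαβ
    exact Prod.lex_def.2 hαβ
  · rintro α (h | ⟨-, h⟩)
    · exact lt_irrefl _ h
    · exact lt_irrefl _ h
  · rintro α β γ (h | ⟨h, h'⟩) (k | ⟨k, k'⟩)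
    · exact Or.inl (h.trans k)
    · exact Or.inl (k ▸ h)
    · exact Or.inl (h ▸ k)
    · exact Or.inr ⟨h.trans k, h'.trans k'⟩
  · intro α β hne
    rcases lt_trichotomy (expWeight α) (expWeight β) with h | h | h
    · exact Or.inl (Or.inl h)
    · rcases lt_or_gt_of_ne (fun h => hne (toLex.injective h) : toLex α ≠ toLex β) with h' | h'
      · exact Or.inl (Or.inr ⟨h, h'⟩)
      · exact Or.inr (Or.inr ⟨h.symm, h'⟩)
    · exact Or.inr (Or.inl h)
  · intro α hα
    have h0 : expWeight (0 : Lam N →₀ ℕ) = 0 := by simp [expWeight, orderedWord, wordWeight]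
    rcases Nat.eq_zero_or_pos (expWeight α) with h | h
    · refine Or.inr ⟨by rw [h0, h], ?_⟩
      exact lt_of_le_of_ne (Finsupp.toLex_monotone (zero_le (a := α)))
        (fun h => hα (toLex.injective h).symm)
    · exact Or.inl (by rwa [h0])
  · rintro α β γ (h | ⟨h, h'⟩)
    · exact Or.inl (by rw [expWeight_add, expWeight_add]; omega)
    · exact Or.inr ⟨by rw [expWeight_add, expWeight_add, h], by
        rw [toLex_add, toLex_add]; exact add_lt_add_left h' _⟩

/-- The exponent of the leading term of the operator representing `x_{ij}`. -/
noncomputable def rootExp {N : ℕ} (a : Lam N) : ℤ × ℕ →₀ ℕ := pathExp a.1.1 (a.1.2 - a.1.1)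

theorem exists_rep {K : Type} [Field K] {q : K} (hq0 : q ≠ 0) (hq8 : q ^ 8 ≠ 1) (N : ℕ) :
    ∃ ρ : UqPlus K q N →ₐ[K] Module.End K (MvPolynomial (ℤ × ℕ) K),
      ∀ a, HasLead Prod.snd (ρ (xg K q N a)) (rootExp a) := by
  have hp : q ^ 2 ≠ 0 := pow_ne_zero 2 hq0
  have hpp : q ^ 2 - (q ^ 2)⁻¹ ≠ 0 := by
    intro h
    have h1 := mul_inv_cancel₀ hp
    rw [← sub_eq_zero.1 h] at h1
    exact hq8 (by linear_combination (q ^ 4 + 1) * h1)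
  choose c hc0 hc using fun j => exists_tower_diag hp N j
  have hinv : ∀ j, c j * (c j)⁻¹ = 1 := fun j => funext fun v => mul_inv_cancel₀ (hc0 j v)
  obtain ⟨r1, r3, r2, r6, r4, r5⟩ := (isQMatrix_tower hp N).normalised_rel hp
    (e := fun j => rescale (c j)⁻¹) (fun i j h => tower_eq_zero_of_lt _ N h)
    (fun j => by rw [hc, rescale_mul, hinv, rescale_one])
    (fun j => by rw [hc, rescale_mul, mul_comm, hinv, rescale_one])
    (fun j k => rescale_comm _ _)
  obtain ⟨μ, hμ0, hμ⟩ : ∃ μ : K, μ ≠ 0 ∧ (q ^ 2 - (q ^ 2)⁻¹) * μ = q :=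
    ⟨q / (q ^ 2 - (q ^ 2)⁻¹), div_ne_zero hq0 hpp, mul_div_cancel₀ _ hpp⟩
  let g : Lam N → Module.End K (MvPolynomial (ℤ × ℕ) K) := fun a =>
    μ • (tower (q ^ 2) N a.1.1 a.1.2 * rescale (c a.1.2)⁻¹)
  have hg : ∀ a : Lam N, HasLead Prod.snd (g a) (rootExp a) := by
    intro a
    have h := (hasLead_tower hp (s := N) (n := a.1.2 - a.1.1) (by have := a.2; omega) a.1.1).mul
      (hasLead_rescale Prod.snd (c := (c a.1.2)⁻¹) fun v => inv_ne_zero (hc0 _ v))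
    rw [zero_add, show ((a.1.1 : ℤ) + (a.1.2 - a.1.1 : ℕ)) = a.1.2 by have := a.2; omega] at h
    exact h.smul hμ0
  have hrel : ∀ ⦃x y⦄, JimboRel K q N x y → FreeAlgebra.lift K g x = FreeAlgebra.lift K g y := by
    intro x y h
    cases h with
    | c1 a b h h' =>
      have := r1 a.1.1 a.1.2 b.1.2 (by have := a.2; omega) (by omega)
      simp only [map_mul, map_smul, FreeAlgebra.lift_ι_apply, g, ← h, smul_mul_smul_comm, this]
      rw [smul_comm]
    | c3 a b h h' =>
      have := r3 a.1.1 b.1.1 a.1.2 (by omega) (by have := b.2; omega)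
      simp only [map_mul, map_smul, FreeAlgebra.lift_ι_apply, g, ← h', smul_mul_smul_comm, this]
      rw [smul_comm]
    | c2 a b h h' =>
      have := r2 a.1.1 b.1.1 b.1.2 a.1.2 (by omega) (by have := b.2; omega) (by omega)
      simp only [map_mul, FreeAlgebra.lift_ι_apply, g, smul_mul_smul_comm, this]
    | c6 a b h =>
      have := r6 a.1.1 a.1.2 b.1.1 b.1.2 (by have := a.2; omega) (by omega) (by have := b.2; omega)
      simp only [map_mul, FreeAlgebra.lift_ι_apply, g, smul_mul_smul_comm, this]
    | c4 a b c' d h h' h'' hc' hd =>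
      have := r4 a.1.1 b.1.1 a.1.2 b.1.2 (by omega) (by omega) (by omega)
      simp only [map_mul, map_sub, map_smul, FreeAlgebra.lift_ι_apply, g, smul_mul_smul_comm, this,
        hc', hd]
      rw [smul_sub, smul_comm (q ^ 2 - (q ^ 2)⁻¹)]
    | c5 a b c' h hc' =>
      have := r5 a.1.1 a.1.2 b.1.2 (by have := a.2; omega) (by have := b.2; omega)
      simp only [map_mul, map_sub, map_smul, FreeAlgebra.lift_ι_apply, g, smul_mul_smul_comm, ← h,
        this, hc']
      have hs : μ * μ * (q ^ 2 - (q ^ 2)⁻¹) = q * μ := by linear_combination μ * hμ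
      rw [smul_sub, smul_comm (q ^ 2), smul_smul q μ, smul_smul (μ * μ) (q ^ 2 - (q ^ 2)⁻¹), hs]
  refine ⟨RingQuot.liftAlgHom K ⟨FreeAlgebra.lift K g, hrel⟩, fun a => ?_⟩
  rw [xg, RingQuot.liftAlgHom_mkAlgHom_apply, FreeAlgebra.lift_ι_apply]
  exact hg a

theorem sum_rootExp_apply {N : ℕ} (l : List (Lam N)) (a : Lam N) :
    (l.map rootExp).sum ((a.1.2 : ℤ), a.1.2 - a.1.1 - 1) =
      l.count a + (l.map rootExp).sum ((a.1.2 : ℤ) + 1, a.1.2 - a.1.1) := by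
  induction l with
  | nil => simp
  | cons b l ih =>
    have hab : b = a ↔ b.1.1 = a.1.1 ∧ b.1.2 = a.1.2 := by
      rw [← Prod.ext_iff]
      exact Subtype.ext_iff
    have ha := a.2
    have hb := b.2
    rw [List.map_cons, List.sum_cons, Finsupp.add_apply, Finsupp.add_apply, ih, List.count_cons,
      rootExp, pathExp_apply, pathExp_apply]
    simp only [beq_iff_eq, hab]
    split_ifs <;> omega

theorem sum_rootExp_orderedWord_injective (N : ℕ) :
    Function.Injective fun α : Lam N →₀ ℕ => ((orderedWord α).map rootExp).sum := by
  intro α β h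
  have hcount : ∀ (γ : Lam N →₀ ℕ) a, (orderedWord γ).count a = γ a := fun γ a => by
    rw [← Multiset.coe_count, coe_orderedWord, Finsupp.count_toMultiset]
  ext a
  have h1 := sum_rootExp_apply (orderedWord α) a
  have h2 := sum_rootExp_apply (orderedWord β) a
  dsimp only at h
  rw [h, hcount] at h1
  rw [hcount] at h2
  omega

theorem linearIndependent_mon {K : Type} [Field K] {q : K} (hq0 : q ≠ 0) (hq8 : q ^ 8 ≠ 1)
    (N : ℕ) : LinearIndependent K (mon K q N) := by
  obtain ⟨ρ, hρ⟩ := exists_rep hq0 hq8 N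
  refine LinearIndependent.of_comp ((LinearMap.applyₗ (1 : MvPolynomial (ℤ × ℕ) K)) ∘ₗ
    ρ.toLinearMap) (linearIndependent_of_lead (w := Prod.snd)
      (sum_rootExp_orderedWord_injective N) fun α => ?_)
  obtain ⟨c, hc0, hc⟩ := HasLead.list_prod hρ (orderedWord α) 0
  refine ⟨c, hc0, ?_⟩
  have : ρ (mon K q N α) = ((orderedWord α).map fun a => ρ (xg K q N a)).prod := by
    rw [mon_eq_wordProd, wordProd, map_list_prod, List.map_map]
    rfl
  rw [zero_add, ← this] at hc
  exact hc

/-- If q^8 ≠ 1 then U_q^+(A_N) is a solvable polynomial algebra: the ordered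
monomials m_α form a K-basis, and there is a monomial order ≺ on Λ_N →₀ ℕ such that
m_α · m_β = c_{α,β} • m_{α+β} + f_{α,β} with c_{α,β} ≠ 0 and f_{α,β} in the span of the
monomials m_γ with γ ≺ α + β. -/
theorem uqPlus_solvablePolynomialAlgebra (K : Type) [Field K] (q : K) (hq0 : q ≠ 0)
    (hq8 : q ^ 8 ≠ 1) (N : ℕ) (hN : 1 ≤ N) :
    LinearIndependent K (mon K q N) ∧
    Submodule.span K (Set.range (mon K q N)) = ⊤ ∧
    ∃ r : (Lam N →₀ ℕ) → (Lam N →₀ ℕ) → Prop,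
      IsMonomialOrder (Lam N) r ∧
      ∀ α β : Lam N →₀ ℕ, ∃ (c : K) (f : UqPlus K q N), c ≠ 0 ∧
        f ∈ Submodule.span K {m : UqPlus K q N | ∃ γ, r γ (α + β) ∧ m = mon K q N γ} ∧
        mon K q N α * mon K q N β = c • mon K q N (α + β) + f := by
  refine ⟨linearIndependent_mon hq0 hq8 N, span_mon_eq_top hq0, expOrder N,
    isMonomialOrder_expOrder N, fun α β => ?_⟩
  obtain ⟨c, hc0, hc⟩ := exists_mon_mul_mon (q := q) hq0 α β
  refine ⟨c, _, hc0, Submodule.span_mono ?_ hc, (add_sub_cancel _ _).symm⟩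
  rintro _ ⟨γ, hγ, rfl⟩
  exact ⟨γ, Or.inl hγ, rfl⟩
end

section
/- If q^8 ≠ 1, then the tensor product R = U_q^+(A_N) ⊗_K U_q^-(A_N) is a solvable polynomial algebra. Precisely: the elements m_α ⊗ m'_β, indexed by pairs (α, β) of finitely supported functions Λ_N → ℕ, form a K-basis of R, and there exists a monomial order ⊑ on pairs (equivalently, on finitely supported functions Λ_N ⊕ Λ_N → ℕ) such that for all pairs (α₁,β₁), (α₂,β₂) there are a nonzero scalar c ∈ K and an element f in the K-span of { m_γ ⊗ m'_δ : (γ,δ) ⊏ (α₁+α₂, β₁+β₂) } with (m_{α₁} ⊗ m'_{β₁}) · (m_{α₂} ⊗ m'_{β₂}) = c · (m_{α₁+α₂} ⊗ m'_{β₁+β₂}) + f. -/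
open scoped TensorProduct

section Straightening

variable {K A σ : Type*} [Field K] [Ring A] [Algebra K A] (x : σ → A) (h : σ → ℕ)

/-- The span of all words in the generators `x` of `h`-weight less than `k`. -/
def wordSpan (K : Type*) {A σ : Type*} [Field K] [Ring A] [Algebra K A] (x : σ → A) (h : σ → ℕ)
    (k : ℕ) : Submodule K A :=
  Submodule.span K {y | ∃ w : List σ, (w.map h).sum < k ∧ y = (w.map x).prod}

/-- Any two generators commute up to a nonzero scalar and words of smaller weight. -/
def SkewCommutes (K : Type*) {A σ : Type*} [Field K] [Ring A] [Algebra K A] (x : σ → A)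
    (h : σ → ℕ) : Prop :=
  ∀ a b, ∃ c : K, c ≠ 0 ∧ x b * x a - c • (x a * x b) ∈ wordSpan K x h (h a + h b)

variable {x h}

theorem word_mem_wordSpan {w : List σ} {k : ℕ} (hw : (w.map h).sum < k) :
    (w.map x).prod ∈ wordSpan K x h k :=
  Submodule.subset_span ⟨w, hw, rfl⟩

theorem mul_mem_wordSpan (p l : List σ) {k : ℕ} {f : A} (hf : f ∈ wordSpan K x h k) :
    (p.map x).prod * f * (l.map x).prod ∈
      wordSpan K x h ((p.map h).sum + k + (l.map h).sum) := by
  induction hf using Submodule.span_induction with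
  | mem y hy =>
    obtain ⟨w, hw, rfl⟩ := hy
    refine Submodule.subset_span ⟨p ++ w ++ l, ?_, by simp [mul_assoc]⟩
    simp only [List.map_append, List.sum_append]
    omega
  | zero => simp
  | add y z _ _ hy hz => rw [mul_add, add_mul]; exact add_mem hy hz
  | smul c y _ hy =>
    rw [mul_smul_comm, smul_mul_assoc]
    exact Submodule.smul_mem _ c hy

theorem SkewCommutes.perm (hx : SkewCommutes K x h) {l₁ l₂ : List σ} (hl : l₁.Perm l₂) :
    ∀ p : List σ, ∃ c : K, c ≠ 0 ∧
      ((p ++ l₁).map x).prod - c • ((p ++ l₂).map x).prod ∈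
        wordSpan K x h (((p ++ l₁).map h).sum) := by
  induction hl with
  | nil => exact fun p => ⟨1, one_ne_zero, by simp⟩
  | cons a _ ih =>
    intro p
    simpa using ih (p ++ [a])
  | swap a b l =>
    intro p
    obtain ⟨c, hc, hf⟩ := hx a b
    refine ⟨c, hc, ?_⟩
    have := mul_mem_wordSpan p l hf
    convert this using 1
    · congr 1
      simp only [List.map_append, List.map_cons, List.sum_append, List.sum_cons]
      ring
    · simp only [List.map_append, List.map_cons, List.prod_append, List.prod_cons, mul_sub, sub_mul,
        mul_smul_comm, smul_mul_assoc, mul_assoc]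
  | trans h₁ h₂ ih₁ ih₂ =>
    intro p
    obtain ⟨c, hc, hf⟩ := ih₁ p
    obtain ⟨d, hd, hg⟩ := ih₂ p
    have e : ((p ++ _).map h).sum = ((p ++ _).map h).sum :=
      (((h₁.append_left p).map h).sum_eq).symm
    rw [e] at hg
    refine ⟨c * d, mul_ne_zero hc hd, ?_⟩
    convert add_mem hf (Submodule.smul_mem _ c hg) using 1
    rw [smul_sub, mul_smul]
    abel

theorem SkewCommutes.of_lt [LinearOrder σ]
    (hx : ∀ a b, a < b → ∃ c : K, c ≠ 0 ∧
      x b * x a - c • (x a * x b) ∈ wordSpan K x h (h a + h b)) : SkewCommutes K x h := by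
  intro a b
  rcases lt_trichotomy a b with hab | rfl | hab
  · exact hx a b hab
  · exact ⟨1, one_ne_zero, by simp⟩
  · obtain ⟨c, hc, hf⟩ := hx b a hab
    refine ⟨c⁻¹, inv_ne_zero hc, ?_⟩
    rw [add_comm]
    convert Submodule.smul_mem _ (-c⁻¹) hf using 1
    rw [smul_sub, smul_smul, neg_mul, inv_mul_cancel₀ hc]
    simp only [neg_smul, one_smul]
    abel

variable [LinearOrder σ]

/-- The ordered word with letters counted by `α`. -/
noncomputable def sortedWord (α : σ →₀ ℕ) : List σ := (Finsupp.toMultiset α).sort (· ≤ ·)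

theorem prod_map_pow_eq_sortedWord (α : σ →₀ ℕ) :
    ((α.support.sort (· ≤ ·)).map (fun p => x p ^ α p)).prod = ((sortedWord α).map x).prod := by
  have key : sortedWord α =
      (α.support.sort (· ≤ ·)).flatMap (fun p => List.replicate (α p) p) := by
    refine List.Perm.eq_of_pairwise' (r := (· ≤ ·)) (Multiset.pairwise_sort _ _) ?_ ?_
    · have hs := Finset.pairwise_sort α.support (· ≤ ·)
      rw [List.pairwise_flatMap]
      refine ⟨fun a _ => List.pairwise_replicate.2 (Or.inr le_rfl), hs.imp ?_⟩
      intro a b hab y hy z hz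
      rw [List.eq_of_mem_replicate hy, List.eq_of_mem_replicate hz]
      exact hab
    · rw [← Multiset.coe_eq_coe, sortedWord, Multiset.sort_eq, ← Multiset.coe_bind,
        Finset.sort_eq, Finsupp.toMultiset_apply, Finsupp.sum, Multiset.bind, Multiset.join,
        Finset.sum]
      congr 1
      refine Multiset.map_congr rfl fun a _ => ?_
      rw [Multiset.nsmul_singleton, Multiset.coe_replicate]
  rw [key, List.map_flatMap, List.flatMap_def, List.prod_flatten, List.map_map]
  congr 2
  funext p
  simp

theorem sum_map_sortedWord (α : σ →₀ ℕ) :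
    ((sortedWord α).map h).sum = Finsupp.weight h α := by
  rw [← Multiset.sum_coe, ← Multiset.map_coe, sortedWord, Multiset.sort_eq]
  induction α using Finsupp.induction_linear with
  | zero => simp
  | add f g hf hg => rw [map_add, Multiset.map_add, Multiset.sum_add, hf, hg, map_add]
  | single a n => simp [Finsupp.weight_apply, Multiset.map_nsmul, Multiset.sum_nsmul]

theorem perm_sortedWord (w : List σ) :
    w.Perm (sortedWord (Multiset.toFinsupp (w : Multiset σ))) := by
  rw [← Multiset.coe_eq_coe, sortedWord, Multiset.sort_eq, Multiset.toFinsupp_toMultiset]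

theorem wordSpan_le_span_sorted (hx : SkewCommutes K x h) (k : ℕ) :
    wordSpan K x h k ≤ Submodule.span K
      {y | ∃ α : σ →₀ ℕ, Finsupp.weight h α < k ∧ y = ((sortedWord α).map x).prod} := by
  induction k using Nat.strong_induction_on with
  | _ k ih =>
    refine Submodule.span_le.2 ?_
    rintro _ ⟨w, hw, rfl⟩
    obtain ⟨c, -, hf⟩ := hx.perm (perm_sortedWord w) []
    rw [← sub_add_cancel (List.map x w).prod (c • ((sortedWord _).map x).prod)]
    refine add_mem ?_ (Submodule.smul_mem _ _ (Submodule.subset_span ⟨_, ?_, rfl⟩))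
    · refine Submodule.span_mono ?_ (ih _ hw hf)
      rintro _ ⟨α, hα, rfl⟩
      exact ⟨α, hα.trans hw, rfl⟩
    · rwa [← sum_map_sortedWord, ← ((perm_sortedWord w).map h).sum_eq]

theorem SkewCommutes.sortedWord_mul (hx : SkewCommutes K x h) (α β : σ →₀ ℕ) :
    ∃ c : K, c ≠ 0 ∧ ∃ f ∈ Submodule.span K
        {y | ∃ γ : σ →₀ ℕ, Finsupp.weight h γ < Finsupp.weight h (α + β) ∧
          y = ((sortedWord γ).map x).prod},
      ((sortedWord α).map x).prod * ((sortedWord β).map x).prod =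
        c • ((sortedWord (α + β)).map x).prod + f := by
  have hp : (sortedWord α ++ sortedWord β).Perm (sortedWord (α + β)) := by
    rw [← Multiset.coe_eq_coe, ← Multiset.coe_add]
    simp [sortedWord]
  obtain ⟨c, hc, hf⟩ := hx.perm hp []
  refine ⟨c, hc, _, ?_, (add_sub_cancel _ _).symm⟩
  have := wordSpan_le_span_sorted hx _ hf
  simpa [sum_map_sortedWord] using this

theorem SkewCommutes.word_mem_span (hx : SkewCommutes K x h) (w : List σ) :
    (w.map x).prod ∈ Submodule.span K
      (Set.range fun α : σ →₀ ℕ => ((sortedWord α).map x).prod) := by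
  refine Submodule.span_mono ?_
    (wordSpan_le_span_sorted hx _ (word_mem_wordSpan (Nat.lt_succ_self _)))
  rintro _ ⟨α, -, rfl⟩
  exact ⟨α, rfl⟩

end Straightening

section MonomialOrder

/-- A weight refined by the lexicographic order. -/
theorem exists_monomialOrder_of_weight {σ : Type} [LinearOrder σ] [Finite σ]
    (W : (σ →₀ ℕ) →+ ℕ) :
    ∃ r : ((σ →₀ ℕ) × (σ →₀ ℕ)) → ((σ →₀ ℕ) × (σ →₀ ℕ)) → Prop,
      WellFounded r ∧ (∀ p, ¬ r p p) ∧ (∀ p₁ p₂ p₃, r p₁ p₂ → r p₂ p₃ → r p₁ p₃) ∧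
      (∀ p₁ p₂, p₁ ≠ p₂ → r p₁ p₂ ∨ r p₂ p₁) ∧
      (∀ p, p ≠ (0, 0) → r (0, 0) p) ∧
      (∀ p₁ p₂ γ δ, r p₁ p₂ → r (p₁.1 + γ, p₁.2 + δ) (p₂.1 + γ, p₂.2 + δ)) ∧
      ∀ p₁ p₂, W p₁.1 + W p₁.2 < W p₂.1 + W p₂.2 → r p₁ p₂ := by
  let s := (MonomialOrder.lex (σ := σ)).toSyn
  let κ : ((σ →₀ ℕ) × (σ →₀ ℕ)) → ℕ ×ₗ ((MonomialOrder.lex (σ := σ)).syn ×ₗ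
    (MonomialOrder.lex (σ := σ)).syn) :=
    fun p => toLex (W p.1 + W p.2, toLex (s p.1, s p.2))
  have hκ : Function.Injective κ := by
    intro p p' hp
    simp only [κ, EmbeddingLike.apply_eq_iff_eq, Prod.mk.injEq] at hp
    exact Prod.ext hp.2.1 hp.2.2
  have hadd : ∀ p p', κ (p + p') = κ p + κ p' := by
    intro p p'
    simp only [κ, Prod.fst_add, Prod.snd_add, map_add, ← toLex_add, Prod.mk_add_mk]
    rw [add_add_add_comm]
  have wf : WellFoundedLT (ℕ ×ₗ ((MonomialOrder.lex (σ := σ)).syn ×ₗ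
    (MonomialOrder.lex (σ := σ)).syn)) := inferInstance
  refine ⟨fun p p' => κ p < κ p', InvImage.wf κ wf.wf, fun p => lt_irrefl _,
    fun _ _ _ => lt_trans, fun p p' hp => lt_or_gt_of_ne (hκ.ne hp), fun p hp => ?_,
    fun p p' γ δ hp => ?_, fun p p' hp => Prod.Lex.toLex_lt_toLex.2 (Or.inl hp)⟩
  · refine lt_of_le_of_ne ?_ (hκ.ne hp.symm)
    simp only [κ, Prod.Lex.toLex_le_toLex, map_zero]
    rcases Nat.eq_zero_or_pos (W p.1 + W p.2) with h0 | h0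
    · refine Or.inr ⟨h0.symm, ?_⟩
      rcases (MonomialOrder.zero_le _ (s p.1)).lt_or_eq with h1 | h1
      · exact Or.inl h1
      · exact Or.inr ⟨h1, MonomialOrder.zero_le _ _⟩
    · exact Or.inl h0
  · have := hadd p (γ, δ)
    have h' := hadd p' (γ, δ)
    change κ (p + (γ, δ)) < κ (p' + (γ, δ))
    rw [this, h']
    exact add_lt_add_left hp _

end MonomialOrder

section RTT

variable {K A ι : Type*} [Field K] [Ring A] [Algebra K A] [LinearOrder ι]

/-- The quadratic exchange (RTT) relations of quantum matrices with parameter `Q`. -/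
structure IsQuantumMatrix (Q : K) (T : ι → ι → A) : Prop where
  row : ∀ i j l, j < l → T i l * T i j = Q⁻¹ • (T i j * T i l)
  col : ∀ i k j, i < k → T k j * T i j = Q⁻¹ • (T i j * T k j)
  nest : ∀ i k j l, i < k → j < l → T k j * T i l = T i l * T k j
  cross : ∀ i k j l, i < k → j < l →
    T k l * T i j = T i j * T k l - (Q - Q⁻¹) • (T i l * T k j)

/-- The exchange relations in the uniform form `R̂ (T ⊗ T) = (T ⊗ T) R̂`. -/
def Exchange (Q : K) (T : ι → ι → A) : Prop :=
  ∀ i k j l, (if i = k then Q else 1) • (T k j * T i l)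
      + (if i < k then Q - Q⁻¹ else 0) • (T i j * T k l)
    = (if j = l then Q else 1) • (T i l * T k j)
      + (if j < l then Q - Q⁻¹ else 0) • (T i j * T k l)

theorem eq_sub_smul_mul_of_eq_zero {x y u : A} (hu : u = 0) (c : K) (z : A) (h : x = y) :
    x = y - c • (z * u) := by
  rw [h, hu, mul_zero, smul_zero, sub_zero]

theorem IsQuantumMatrix.exchange {Q : K} (hQ : Q ≠ 0) {T : ι → ι → A}
    (h : IsQuantumMatrix Q T) : Exchange Q T := by
  intro i k j l
  rcases lt_trichotomy i k with hik | rfl | hik <;> rcases lt_trichotomy j l with hjl | rfl | hjl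
  · simp [hik, hjl, hik.ne, hjl.ne, h.nest i k j l hik hjl]
  · simp only [hik, hik.ne, if_true, if_false, lt_irrefl, h.col i k j hik]
    module
  · simp only [hik, hik.ne, hjl.not_gt, hjl.ne', if_true, if_false, h.cross i k l j hik hjl]
    module
  · simp only [hjl, hjl.ne, if_true, if_false, lt_irrefl, h.row i j l hjl]
    module
  · simp
  · simp only [hjl.not_gt, hjl.ne', if_true, if_false, lt_irrefl, h.row i l j hjl, smul_smul,
      mul_inv_cancel₀ hQ]
  · simp only [hjl, hik.ne', hjl.ne, hik.not_gt, if_true, if_false, h.cross k i j l hik hjl,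
      h.nest k i j l hik hjl]
    module
  · simp only [hik.ne', hik.not_gt, if_true, if_false, lt_irrefl, h.col k i j hik, smul_smul,
      mul_inv_cancel₀ hQ]
  · simp [hik.not_gt, hjl.not_gt, hik.ne', hjl.ne', h.nest k i l j hik hjl]

theorem Exchange.isQuantumMatrix {Q : K} (hQ : Q ≠ 0) {T : ι → ι → A}
    (h : Exchange Q T) : IsQuantumMatrix Q T where
  row i j l hjl := by
    have := h i i l j
    simp only [hjl.not_gt, hjl.ne', if_true, if_false, lt_irrefl, zero_smul, add_zero,
      one_smul] at this
    rw [← this, smul_smul, inv_mul_cancel₀ hQ, one_smul]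
  col i k j hik := by
    have := h k i j j
    simp only [hik.not_gt, hik.ne', if_true, if_false, lt_irrefl, zero_smul, add_zero,
      one_smul] at this
    rw [this, smul_smul, inv_mul_cancel₀ hQ, one_smul]
  nest i k j l hik hjl := by
    have := h i k j l
    simpa [hik, hik.ne, hjl, hjl.ne] using this
  cross i k j l hik hjl := by
    have := h i k l j
    simp only [hik, hik.ne, hjl.not_gt, hjl.ne', if_true, if_false, zero_smul, add_zero,
      one_smul] at this
    rw [← this]
    abel

theorem Exchange.mul [Fintype ι] {Q : K} {T U : ι → ι → A} (hT : Exchange Q T)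
    (hU : Exchange Q U) (hc : ∀ i j k l, Commute (T i j) (U k l)) :
    Exchange Q (fun i j => ∑ a, T i a * U a j) := by
  have hprod : ∀ i j k l, (∑ a, T i a * U a j) * (∑ b, T k b * U b l) =
      ∑ a, ∑ b, (T i a * T k b) * (U a j * U b l) := by
    intro i j k l
    rw [Finset.sum_mul_sum]
    refine Finset.sum_congr rfl fun a _ => Finset.sum_congr rfl fun b _ => ?_
    exact ((hc k b a j).symm).mul_mul_mul_comm _ _
  intro i k j l
  simp only [hprod]
  calc _ = ∑ a, ∑ b, ((if i = k then Q else 1) • (T k a * T i b)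
          + (if i < k then Q - Q⁻¹ else 0) • (T i a * T k b)) * (U a j * U b l) := by
        simp only [Finset.smul_sum, ← Finset.sum_add_distrib, add_mul, smul_mul_assoc]
    _ = ∑ a, ∑ b, ((if a = b then Q else 1) • (T i b * T k a)
          + (if a < b then Q - Q⁻¹ else 0) • (T i a * T k b)) * (U a j * U b l) := by
        simp only [hT i k]
    _ = (∑ a, ∑ b, (T i b * T k a) * ((if a = b then Q else 1) • (U a j * U b l))) +
          ∑ a, ∑ b, (T i a * T k b) * ((if a < b then Q - Q⁻¹ else 0) • (U a j * U b l)) := by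
        simp only [← Finset.sum_add_distrib, add_mul, smul_mul_assoc, mul_smul_comm]
    _ = ∑ a, ∑ b, (T i a * T k b) * ((if a = b then Q else 1) • (U b j * U a l)
          + (if a < b then Q - Q⁻¹ else 0) • (U a j * U b l)) := by
        rw [Finset.sum_comm]
        simp only [← Finset.sum_add_distrib, mul_add, eq_comm]
    _ = ∑ a, ∑ b, (T i a * T k b) * ((if j = l then Q else 1) • (U a l * U b j)
          + (if j < l then Q - Q⁻¹ else 0) • (U a j * U b l)) := by
        simp only [hU _ _ j l]
    _ = _ := by
        simp only [Finset.smul_sum, ← Finset.sum_add_distrib, mul_add, mul_smul_comm]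

end RTT

section ShiftOperators

variable {K G : Type*} [Field K] [AddCommGroup G]

/-- The weighted shift `δ_a ↦ f a • δ_{a + t}` on `G →₀ K`. -/
noncomputable def weightedShift (f : G → K) (t : G) : Module.End K (G →₀ K) :=
  Finsupp.linearCombination K fun a => Finsupp.single (a + t) (f a)

@[simp]
theorem weightedShift_single (f : G → K) (t a : G) (c : K) :
    weightedShift f t (Finsupp.single a c) = Finsupp.single (a + t) (c * f a) := by
  simp [weightedShift]

theorem weightedShift_mul (f g : G → K) (t s : G) :
    weightedShift f t * weightedShift g s =
      weightedShift (fun a => g a * f (a + s)) (s + t) := by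
  ext a : 2
  simp [Module.End.mul_apply, add_assoc]

theorem weightedShift_sub (f g : G → K) {t s : G} (hts : t = s) :
    weightedShift f t - weightedShift g s = weightedShift (fun a => f a - g a) t := by
  subst hts
  ext a : 2
  simp

theorem smul_weightedShift (c : K) (f : G → K) (t : G) :
    c • weightedShift f t = weightedShift (fun a => c * f a) t := by
  ext a : 2
  simp

theorem weightedShift_congr {f g : G → K} {t s : G} (hts : t = s) (hfg : ∀ a, f a = g a) :
    weightedShift f t = weightedShift g s := by
  rw [hts, funext hfg]

theorem weightedShift_commute {f g : G → K} {t s : G} (hf : ∀ a, f (a + s) = f a)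
    (hg : ∀ a, g (a + t) = g a) : Commute (weightedShift f t) (weightedShift g s) := by
  rw [commute_iff_eq, weightedShift_mul, weightedShift_mul]
  exact weightedShift_congr (add_comm _ _) fun a => by rw [hf, hg, mul_comm]

theorem isUnit_weightedShift_zero {f : G → K} (hf : ∀ a, f a ≠ 0) :
    IsUnit (weightedShift f 0) := by
  refine ⟨⟨weightedShift f 0, weightedShift (fun a => (f a)⁻¹) 0, ?_, ?_⟩, rfl⟩ <;>
  · ext a : 2
    simp [hf a]

end ShiftOperators

section RowMatrix

variable {K : Type*} [Field K]

/-- The unit vector at position `(s, x)`. -/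
def unitAt (s x : ℕ) : ℕ → ℕ → ℤ := Pi.single s (Pi.single x 1)

/-- The partial sums of the `s`-th row of `a`. -/
def rowSum (s : ℕ) (a : ℕ → ℕ → ℤ) (x : ℕ) : ℤ := ∑ l ∈ Finset.range x, a s l

theorem unitAt_same (s x y : ℕ) : unitAt s x s y = if y = x then 1 else 0 := by
  simp [unitAt, Pi.single_apply]

theorem unitAt_of_ne {s t : ℕ} (h : t ≠ s) (x : ℕ) : unitAt s x t = 0 := by
  simp [unitAt, h]

theorem rowSum_succ (s : ℕ) (a : ℕ → ℕ → ℤ) (x : ℕ) :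
    rowSum s a (x + 1) = rowSum s a x + a s x := Finset.sum_range_succ _ _

theorem rowSum_shift (s : ℕ) (a : ℕ → ℕ → ℤ) (n j x : ℕ) :
    rowSum s (a + (unitAt s n - unitAt s j)) x =
      rowSum s a x + ((if n < x then 1 else 0) - (if j < x then 1 else 0)) := by
  simp [rowSum, Finset.sum_add_distrib, unitAt_same]

theorem apply_shift (s : ℕ) (a : ℕ → ℕ → ℤ) (n j x : ℕ) :
    (a + (unitAt s n - unitAt s j)) s x =
      a s x + ((if x = n then 1 else 0) - (if x = j then 1 else 0)) := by
  simp [unitAt_same]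

/-- The coefficient of the entry `(j, n)`, `j < n`, of the elementary quantum matrix. -/
noncomputable def rowCoeff (Q : K) (s j n : ℕ) (a : ℕ → ℕ → ℤ) : K :=
  (Q ^ (-(2 * a s j)) - if j = s then 0 else 1) * Q ^ (rowSum s a (j + 1) - rowSum s a n)

/-- The elementary upper triangular quantum matrix attached to the row `s`, acting on
Laurent polynomials. -/
noncomputable def rowMatrix (Q : K) (s j n : ℕ) : Module.End K ((ℕ → ℕ → ℤ) →₀ K) :=
  if j < n then weightedShift (fun a => Q * rowCoeff Q s j n a) (unitAt s n - unitAt s j)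
  else if j = n then weightedShift (fun a => Q ^ (-a s j)) 0 else 0

theorem rowMatrix_of_lt (Q : K) (s : ℕ) {j n : ℕ} (h : j < n) : rowMatrix Q s j n =
    weightedShift (fun a => Q * rowCoeff Q s j n a) (unitAt s n - unitAt s j) := if_pos h

theorem rowMatrix_self (Q : K) (s j : ℕ) : rowMatrix Q s j j =
    weightedShift (fun a => Q ^ (-a s j)) 0 := by simp [rowMatrix]

theorem rowMatrix_of_gt (Q : K) (s : ℕ) {j n : ℕ} (h : n < j) : rowMatrix Q s j n = 0 := by
  simp [rowMatrix, h.not_gt, h.ne']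

theorem isQuantumMatrix_rowMatrix {Q : K} (hQ : Q ≠ 0) (s : ℕ) :
    IsQuantumMatrix Q (rowMatrix Q s) where
  row i j l hjl := by
    rcases lt_trichotomy i j with hij | rfl | hij
    on_goal 3 => simp [rowMatrix_of_gt Q s hij]
    on_goal 1 => rw [rowMatrix_of_lt Q s hij, rowMatrix_of_lt Q s (hij.trans hjl)]
    on_goal 2 => rw [rowMatrix_self, rowMatrix_of_lt Q s hjl]
    all_goals
      simp only [weightedShift_mul, smul_weightedShift, zero_add, add_zero]
      refine weightedShift_congr (by abel) fun a => ?_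
      simp (disch := omega) only [rowCoeff, rowSum_shift, apply_shift, if_pos, if_neg, if_true]
      simp (disch := assumption) only [zpow_add₀, zpow_sub₀, zpow_neg, mul_add, mul_sub, two_mul,
        zpow_zero, zpow_one]
      field_simp
      try ring
  col i k j hik := by
    rcases lt_trichotomy k j with hkj | rfl | hkj
    on_goal 3 => simp [rowMatrix_of_gt Q s hkj]
    on_goal 1 => rw [rowMatrix_of_lt Q s hkj, rowMatrix_of_lt Q s (hik.trans hkj)]
    on_goal 2 => rw [rowMatrix_self, rowMatrix_of_lt Q s hik]
    all_goals
      simp only [weightedShift_mul, smul_weightedShift, zero_add, add_zero]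
      refine weightedShift_congr (by abel) fun a => ?_
      simp (disch := omega) only [rowCoeff, rowSum_shift, apply_shift, if_pos, if_neg, if_true]
      simp (disch := assumption) only [zpow_add₀, zpow_sub₀, zpow_neg, mul_add, mul_sub, two_mul,
        zpow_zero, zpow_one]
      field_simp
      try ring
  nest i k j l hik hjl := by
    rcases lt_trichotomy k j with hkj | rfl | hkj
    on_goal 3 => simp [rowMatrix_of_gt Q s hkj]
    on_goal 1 =>
      rw [rowMatrix_of_lt Q s hkj, rowMatrix_of_lt Q s (hik.trans (hkj.trans hjl))]
    on_goal 2 => rw [rowMatrix_self, rowMatrix_of_lt Q s (hik.trans hjl)]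
    all_goals
      simp only [weightedShift_mul, zero_add, add_zero]
      refine weightedShift_congr (by abel) fun a => ?_
      simp (disch := omega) only [rowCoeff, rowSum_shift, apply_shift, if_pos, if_neg]
      simp (disch := assumption) only [zpow_add₀, zpow_sub₀, zpow_neg, mul_add, mul_sub, two_mul,
        zpow_zero, zpow_one]
      field_simp
      try ring
  cross i k j l hik hjl := by
    rcases lt_trichotomy k j with hkj | rfl | hkj
    · rw [rowMatrix_of_lt Q s (hkj.trans hjl), rowMatrix_of_lt Q s (hik.trans hkj),
        rowMatrix_of_lt Q s hkj, rowMatrix_of_lt Q s (hik.trans (hkj.trans hjl))]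
      simp only [weightedShift_mul, smul_weightedShift]
      rw [weightedShift_sub _ _ (by abel)]
      refine weightedShift_congr (by abel) fun a => ?_
      simp (disch := omega) only [rowCoeff, rowSum_shift, apply_shift, if_pos, if_neg]
      simp (disch := assumption) only [zpow_add₀, zpow_sub₀, zpow_neg, mul_add, mul_sub, two_mul,
        zpow_zero, zpow_one]
      field_simp
      try ring
    · rw [rowMatrix_self, rowMatrix_of_lt Q s hjl, rowMatrix_of_lt Q s hik,
        rowMatrix_of_lt Q s (hik.trans hjl)]
      simp only [weightedShift_mul, smul_weightedShift, zero_add, add_zero]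
      rw [weightedShift_sub _ _ (by abel)]
      refine weightedShift_congr (by abel) fun a => ?_
      simp (disch := omega) only [rowCoeff, rowSum_shift, apply_shift, if_pos, if_neg, if_true,
        rowSum_succ]
      simp (disch := assumption) only [zpow_add₀, zpow_sub₀, zpow_neg, mul_add, mul_sub, two_mul,
        zpow_zero, zpow_one]
      field_simp
      try ring
    · refine eq_sub_smul_mul_of_eq_zero (rowMatrix_of_gt Q s hkj) _ _ ?_
      rcases lt_trichotomy i j with hij | rfl | hij
      on_goal 3 => simp [rowMatrix_of_gt Q s hij]
      all_goals
        rcases lt_trichotomy k l with hkl | rfl | hkl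
        on_goal 3 => simp [rowMatrix_of_gt Q s hkl]
      on_goal 1 => rw [rowMatrix_of_lt Q s hij, rowMatrix_of_lt Q s hkl]
      on_goal 2 => rw [rowMatrix_of_lt Q s hij, rowMatrix_self]
      on_goal 3 => rw [rowMatrix_self, rowMatrix_of_lt Q s hkl]
      on_goal 4 =>
        rw [rowMatrix_self, rowMatrix_self]
        exact weightedShift_commute (by simp) (by simp)
      all_goals
        simp only [weightedShift_mul, zero_add, add_zero]
        refine weightedShift_congr (by abel) fun a => ?_
        simp (disch := omega) only [rowCoeff, rowSum_shift, apply_shift, if_pos, if_neg]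
        simp (disch := assumption) only [zpow_add₀, zpow_sub₀, zpow_neg, mul_add, mul_sub, two_mul,
          zpow_zero, zpow_one]
        field_simp
        try ring

end RowMatrix

theorem Commute.ringInverse_left {A : Type*} [Ring A] {x y : A} (h : Commute x y) :
    Commute (Ring.inverse x) y := by
  by_cases hx : IsUnit x
  · obtain ⟨u, rfl⟩ := hx
    rw [Ring.inverse_unit]
    exact h.units_inv_left
  · rw [Ring.inverse_non_unit _ hx]
    exact Commute.zero_left _

section Triangular

variable {K A ι : Type*} [Field K] [Ring A] [Algebra K A] [LinearOrder ι] {Q : K} {T : ι → ι → A}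

/-- The normalized entries `T i i ⁻¹ * T i j` of a triangular quantum matrix. -/
noncomputable def normalizedEntry (T : ι → ι → A) (i j : ι) : A := Ring.inverse (T i i) * T i j

theorem IsQuantumMatrix.commute_diag (h : IsQuantumMatrix Q T)
    (ht : ∀ i j, j < i → T i j = 0) {m i j : ι} (hij : i ≤ j) (hmi : m ≠ i) (hmj : m ≠ j) :
    Commute (T m m) (T i j) := by
  rw [commute_iff_eq]
  rcases hmi.lt_or_gt with hmi | hmi
  · rw [h.cross m i m j hmi (hmi.trans_le hij), ht i m hmi]
    simp
  · rcases hmj.lt_or_gt with hmj | hmj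
    · exact h.nest i m m j hmi hmj
    · rw [h.cross i m j m hmi hmj, ht m j hmj]
      simp

theorem IsQuantumMatrix.commute_inverse_diag (h : IsQuantumMatrix Q T)
    (ht : ∀ i j, j < i → T i j = 0) {m i j : ι} (hij : i ≤ j) (hmi : m ≠ i) (hmj : m ≠ j) :
    Commute (Ring.inverse (T m m)) (T i j) :=
  (h.commute_diag ht hij hmi hmj).ringInverse_left

theorem IsQuantumMatrix.commute_inverse_inverse (h : IsQuantumMatrix Q T)
    (ht : ∀ i j, j < i → T i j = 0) (i m : ι) :
    Commute (Ring.inverse (T m m)) (Ring.inverse (T i i)) := by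
  rcases eq_or_ne m i with rfl | hmi
  · exact Commute.refl _
  · exact (h.commute_inverse_diag ht le_rfl hmi hmi).symm.ringInverse_left.symm

/-- Moving the inverse of a unit past an element that skew-commutes with it. -/
theorem mul_inverse_of_skew {x y : A} {c : K} (hx : IsUnit x) (h : x * y = c • (y * x)) :
    c • (Ring.inverse x * y) = y * Ring.inverse x := by
  have := congrArg (fun z => Ring.inverse x * z * Ring.inverse x) h
  simp only [← mul_assoc, Ring.inverse_mul_cancel x hx, one_mul, mul_smul_comm, smul_mul_assoc] at this
  rw [this, mul_assoc _ x, Ring.mul_inverse_cancel x hx, mul_one]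

theorem IsQuantumMatrix.normalizedEntry_mul (h : IsQuantumMatrix Q T)
    (ht : ∀ i j, j < i → T i j = 0) {i j m n : ι} (hmn : m ≤ n) (him : i ≠ m) (hin : i ≠ n) :
    normalizedEntry T m n * normalizedEntry T i j =
      Ring.inverse (T i i) * Ring.inverse (T m m) * (T m n * T i j) := by
  rw [normalizedEntry, normalizedEntry,
    ((h.commute_inverse_diag ht hmn him hin).symm).mul_mul_mul_comm,
    (h.commute_inverse_inverse ht i m).eq]

theorem IsQuantumMatrix.normalizedEntry_row (h : IsQuantumMatrix Q T) (hQ : Q ≠ 0)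
    (hu : ∀ i, IsUnit (T i i)) {i j n : ι} (hij : i < j) (hjn : j < n) :
    normalizedEntry T i n * normalizedEntry T i j =
      Q⁻¹ • (normalizedEntry T i j * normalizedEntry T i n) := by
  have key : ∀ k, i < k → T i k * Ring.inverse (T i i) = Q • (Ring.inverse (T i i) * T i k) := by
    intro k hik
    refine (mul_inverse_of_skew (hu i) ?_).symm
    rw [h.row i i k hik, smul_smul, mul_inv_cancel₀ hQ, one_smul]
  have e : ∀ k l, i < k → normalizedEntry T i k * normalizedEntry T i l =
      Q • (Ring.inverse (T i i) * Ring.inverse (T i i) * (T i k * T i l)) := by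
    intro k l hik
    rw [normalizedEntry, normalizedEntry, mul_assoc, ← mul_assoc (T i k), key k hik]
    simp only [mul_smul_comm, smul_mul_assoc, mul_assoc]
  rw [e n j (hij.trans hjn), e j n hij, h.row i j n hjn, mul_smul_comm, smul_comm]

theorem IsQuantumMatrix.normalizedEntry_adjacent (h : IsQuantumMatrix Q T) (hQ : Q ≠ 0)
    (ht : ∀ i j, j < i → T i j = 0) (hu : ∀ i, IsUnit (T i i)) {i j n : ι} (hij : i < j)
    (hjn : j < n) :
    normalizedEntry T j n * normalizedEntry T i j =
      Q • (normalizedEntry T i j * normalizedEntry T j n)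
        - (Q - Q⁻¹) • normalizedEntry T i n := by
  have e : T i j * Ring.inverse (T j j) = Q⁻¹ • (Ring.inverse (T j j) * T i j) :=
    (mul_inverse_of_skew (hu j) (h.col i j j hij)).symm
  have e₁ : normalizedEntry T i j * normalizedEntry T j n =
      Q⁻¹ • (Ring.inverse (T i i) * Ring.inverse (T j j) * (T i j * T j n)) := by
    rw [normalizedEntry, normalizedEntry, mul_assoc, ← mul_assoc (T i j), e]
    simp only [mul_smul_comm, smul_mul_assoc, mul_assoc]
  have e₂ : Ring.inverse (T i i) * Ring.inverse (T j j) * (T i n * T j j) =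
      normalizedEntry T i n := by
    rw [← (h.commute_diag ht (hij.trans hjn).le hij.ne' hjn.ne).eq, mul_assoc,
      ← mul_assoc _ (T j j), Ring.inverse_mul_cancel _ (hu j), one_mul, normalizedEntry]
  rw [h.normalizedEntry_mul ht hjn.le hij.ne (hij.trans hjn).ne, h.cross i j j n hij hjn, e₁,
    smul_smul, mul_inv_cancel₀ hQ, one_smul, mul_sub, mul_smul_comm, e₂]

theorem isQuantumMatrix_one (Q : K) :
    IsQuantumMatrix Q fun i j : ι => if i = j then (1 : A) else 0 where
  row i j l h := by
    rcases eq_or_ne i j with rfl | hij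
    · simp [h.ne]
    · simp [hij]
  col i k j h := by
    rcases eq_or_ne i j with rfl | hij
    · simp [h.ne']
    · simp [hij]
  nest i k j l _ _ := by split_ifs <;> simp
  cross i k j l h h' := by
    have : (if i = l then (1 : A) else 0) * (if k = j then 1 else 0) = 0 := by
      split_ifs with h₁ h₂
      · exact absurd (h.trans_eq h₂) (h'.trans_eq h₁.symm).not_gt
      all_goals simp
    rw [this, smul_zero, sub_zero]
    split_ifs <;> simp

end Triangular

section ProductMatrix

variable {K : Type*} [Field K]

theorem exists_rowMatrix_eq (Q : K) (s j n : ℕ) :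
    ∃ f t, rowMatrix Q s j n = weightedShift f t ∧ (∀ r, r ≠ s → t r = 0) ∧
      ∀ a b : ℕ → ℕ → ℤ, b s = 0 → f (a + b) = f a := by
  rcases lt_trichotomy j n with h | rfl | h
  · refine ⟨_, _, rowMatrix_of_lt Q s h, fun r hr => ?_, fun a b hb => ?_⟩
    · simp [unitAt_of_ne hr]
    · simp [rowCoeff, rowSum, hb]
  · exact ⟨_, _, rowMatrix_self Q s j, fun r hr => rfl, fun a b hb => by simp [hb]⟩
  · refine ⟨0, 0, ?_, fun _ _ => rfl, fun _ _ _ => rfl⟩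
    rw [rowMatrix_of_gt Q s h]
    ext a : 2
    simp

theorem rowMatrix_commute (Q : K) {s t : ℕ} (hst : s ≠ t) (i j k l : ℕ) :
    Commute (rowMatrix Q s i j) (rowMatrix Q t k l) := by
  obtain ⟨f, u, hf, hu, hfu⟩ := exists_rowMatrix_eq Q s i j
  obtain ⟨g, v, hg, hv, hgv⟩ := exists_rowMatrix_eq Q t k l
  rw [hf, hg]
  exact weightedShift_commute (fun a => hfu a v (hv s hst)) fun a => hgv a u (hu t hst.symm)

/-- The product of the elementary quantum matrices attached to the rows `t - 1, …, 0`. -/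
noncomputable def productMatrix (Q : K) (n : ℕ) :
    ℕ → Fin n → Fin n → Module.End K ((ℕ → ℕ → ℤ) →₀ K)
  | 0 => fun i j => if i = j then 1 else 0
  | t + 1 => fun i j => ∑ a : Fin n, rowMatrix Q t i a * productMatrix Q n t a j

variable (Q : K) {n : ℕ}

theorem rowMatrix_commute_productMatrix {s t : ℕ} (hts : t ≤ s) (i j : ℕ) (k l : Fin n) :
    Commute (rowMatrix Q s i j) (productMatrix Q n t k l) := by
  induction t generalizing k l with
  | zero =>
    simp only [productMatrix]
    split_ifs
    exacts [Commute.one_right _, Commute.zero_right _]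
  | succ t ih =>
    exact Commute.sum_right _ _ _ fun a _ =>
      (rowMatrix_commute Q (by omega) _ _ _ _).mul_right (ih (by omega) a l)

theorem productMatrix_succ (t : ℕ) (i j : Fin n) : productMatrix Q n (t + 1) i j =
    ∑ a : Fin n, productMatrix Q n t a j * rowMatrix Q t i a :=
  Finset.sum_congr rfl fun _ _ => (rowMatrix_commute_productMatrix Q le_rfl _ _ _ _).eq

theorem productMatrix_of_gt (t : ℕ) {i j : Fin n} (h : j < i) : productMatrix Q n t i j = 0 := by
  induction t generalizing i j with
  | zero => simp [productMatrix, h.ne']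
  | succ t ih =>
    refine Finset.sum_eq_zero fun a _ => ?_
    rcases lt_or_ge a i with hai | hai
    · rw [rowMatrix_of_gt Q t hai, zero_mul]
    · rw [ih (h.trans_le hai), mul_zero]

variable {Q}

theorem isUnit_productMatrix (hQ : Q ≠ 0) (t : ℕ) (i : Fin n) :
    IsUnit (productMatrix Q n t i i) := by
  induction t with
  | zero => simp [productMatrix]
  | succ t ih =>
    have : productMatrix Q n (t + 1) i i = rowMatrix Q t i i * productMatrix Q n t i i := by
      refine Finset.sum_eq_single i (fun a _ ha => ?_) (by simp)
      rcases ha.lt_or_gt with hai | hai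
      · rw [rowMatrix_of_gt Q t hai, zero_mul]
      · rw [productMatrix_of_gt Q t hai, mul_zero]
    rw [this, rowMatrix_self]
    exact (isUnit_weightedShift_zero fun a => zpow_ne_zero _ hQ).mul ih

theorem isQuantumMatrix_productMatrix (hQ : Q ≠ 0) (t : ℕ) :
    IsQuantumMatrix Q (productMatrix Q n t) := by
  refine Exchange.isQuantumMatrix hQ ?_
  induction t with
  | zero => exact (isQuantumMatrix_one Q).exchange hQ
  | succ t ih =>
    refine Exchange.mul (T := fun i j : Fin n => rowMatrix Q t i j) ?_ ih
      fun i j k l => rowMatrix_commute_productMatrix Q le_rfl _ _ _ _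
    intro i k j l
    have := (isQuantumMatrix_rowMatrix hQ t).exchange hQ i k j l
    simpa only [Fin.val_inj, Fin.val_fin_lt] using this

variable (Q)

theorem rowMatrix_single_of_eq_zero {s m : ℕ} {a : ℕ → ℕ → ℤ} (hms : m ≠ s) (ha : a s m = 0)
    (l : ℕ) (c : K) :
    rowMatrix Q s m l (Finsupp.single a c) = if m = l then Finsupp.single a c else 0 := by
  rcases lt_trichotomy m l with h | rfl | h
  · rw [rowMatrix_of_lt Q s h, weightedShift_single]
    simp [rowCoeff, ha, hms, h.ne]
  · simp [rowMatrix_self, ha]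
  · simp [rowMatrix_of_gt Q s h, h.ne']

theorem productMatrix_succ_single {t : ℕ} {m : Fin n} {a : ℕ → ℕ → ℤ} (hmt : (m : ℕ) ≠ t)
    (ha : a t m = 0) (l : Fin n) (c : K) :
    productMatrix Q n (t + 1) m l (Finsupp.single a c) =
      productMatrix Q n t m l (Finsupp.single a c) := by
  simp only [productMatrix_succ, LinearMap.sum_apply, Module.End.mul_apply,
    rowMatrix_single_of_eq_zero Q hmt ha, Fin.val_inj]
  rw [Finset.sum_eq_single m (fun b _ hb => by simp [hb.symm]) (by simp), if_pos rfl]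

theorem productMatrix_single_of_le {t : ℕ} {m : Fin n} {a : ℕ → ℕ → ℤ} (hmt : t ≤ m)
    (ha : ∀ s < t, a s m = 0) (l : Fin n) (c : K) :
    productMatrix Q n t m l (Finsupp.single a c) = if m = l then Finsupp.single a c else 0 := by
  induction t with
  | zero => simp only [productMatrix]; split_ifs <;> simp
  | succ t ih =>
    rw [productMatrix_succ_single Q (by omega) (ha t (by omega)),
      ih (by omega) fun s hs => ha s (by omega)]

theorem productMatrix_single {t : ℕ} {m : Fin n} {a : ℕ → ℕ → ℤ} (hmt : (m : ℕ) < t)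
    (ha : ∀ s, (m : ℕ) < s → a s m = 0) (ha' : ∀ s < (m : ℕ), a s = 0) (l : Fin n) (c : K) :
    productMatrix Q n t m l (Finsupp.single a c) = rowMatrix Q m m l (Finsupp.single a c) := by
  induction t, hmt using Nat.le_induction with
  | base =>
    simp only [Nat.succ_eq_add_one, productMatrix_succ, LinearMap.sum_apply, Module.End.mul_apply]
    have key : ∀ b : Fin n, productMatrix Q n m b l (rowMatrix Q m m b (Finsupp.single a c)) =
        if b = l then rowMatrix Q m m b (Finsupp.single a c) else 0 := by
      intro b
      rcases lt_or_ge b m with hbm | hbm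
      · simp [rowMatrix_of_gt Q m hbm]
      · obtain ⟨f, u, hf, hu, -⟩ := exists_rowMatrix_eq Q m m b
        rw [hf, weightedShift_single, productMatrix_single_of_le Q hbm]
        intro s hs
        simp [ha' s hs, hu s hs.ne]
    simp only [key]
    simp
  | succ t ht ih =>
    rw [productMatrix_succ_single Q (by omega) (ha t (by omega)), ih]

end ProductMatrix

section Representation

/-- The first component of an index, as a matrix index. -/
def Lam.lo {N : ℕ} (p : Lam N) : Fin (N + 2) := ⟨p.1.1, by have := p.2; omega⟩

/-- The second component of an index, as a matrix index. -/
def Lam.hi {N : ℕ} (p : Lam N) : Fin (N + 2) := ⟨p.1.2, by have := p.2; omega⟩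

theorem Lam.lo_lt_hi {N : ℕ} (p : Lam N) : p.lo < p.hi := p.2.2.1

variable {K : Type} [Field K] {q : K} {N : ℕ} {A : Type*} [Ring A] [Algebra K A]
  {T : Fin (N + 2) → Fin (N + 2) → A}

theorem JimboRel.lift_eq (hq : q ≠ 0) (hΛ : q ^ 2 - (q ^ 2)⁻¹ ≠ 0)
    (h : IsQuantumMatrix (q ^ 2) T) (ht : ∀ i j, j < i → T i j = 0) (hu : ∀ i, IsUnit (T i i))
    {u v : FreeAlgebra K (Lam N)} (huv : JimboRel K q N u v) :
    FreeAlgebra.lift K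
        (fun p : Lam N => (q * (q ^ 2 - (q ^ 2)⁻¹)⁻¹) • normalizedEntry T p.lo p.hi) u =
      FreeAlgebra.lift K
        (fun p : Lam N => (q * (q ^ 2 - (q ^ 2)⁻¹)⁻¹) • normalizedEntry T p.lo p.hi) v := by
  have hQ : q ^ 2 ≠ 0 := pow_ne_zero 2 hq
  have inv_mul : ∀ a b : Lam N, a.lo ≠ b.lo → a.lo ≠ b.hi → b.lo ≠ a.hi →
      normalizedEntry T b.lo b.hi * normalizedEntry T a.lo a.hi =
        Ring.inverse (T a.lo a.lo) * Ring.inverse (T b.lo b.lo) *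
          (T b.lo b.hi * T a.lo a.hi) ∧
      normalizedEntry T a.lo a.hi * normalizedEntry T b.lo b.hi =
        Ring.inverse (T a.lo a.lo) * Ring.inverse (T b.lo b.lo) *
          (T a.lo a.hi * T b.lo b.hi) := by
    intro a b h₁ h₂ h₃
    rw [h.normalizedEntry_mul ht b.lo_lt_hi.le h₁ h₂,
      h.normalizedEntry_mul ht a.lo_lt_hi.le h₁.symm h₃,
      (h.commute_inverse_inverse ht a.lo b.lo).eq]
    exact ⟨rfl, rfl⟩
  induction huv with
  | c1 a b h₁ h₂ =>
    have e : b.lo = a.lo := Fin.ext h₁.symm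
    simp only [map_mul, map_smul, FreeAlgebra.lift_ι_apply, smul_mul_smul_comm]
    rw [e, h.normalizedEntry_row hQ hu a.lo_lt_hi h₂, smul_comm]
  | c3 a b h₁ h₂ =>
    have e : b.hi = a.hi := Fin.ext h₂.symm
    have h₁' : a.lo < b.lo := h₁
    obtain ⟨e₁, e₂⟩ := inv_mul a b h₁'.ne (h₁'.trans b.lo_lt_hi).ne (e ▸ b.lo_lt_hi.ne)
    simp only [map_mul, map_smul, FreeAlgebra.lift_ι_apply, smul_mul_smul_comm]
    rw [e₁, e₂, e, h.col _ _ _ h₁', mul_smul_comm, smul_comm]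
  | c2 a b h₁ h₂ =>
    have h₁' : a.lo < b.lo := h₁
    have h₂' : b.hi < a.hi := h₂
    obtain ⟨e₁, e₂⟩ := inv_mul a b h₁'.ne (h₁'.trans b.lo_lt_hi).ne (b.lo_lt_hi.trans h₂').ne
    simp only [map_mul, FreeAlgebra.lift_ι_apply, smul_mul_smul_comm]
    rw [e₁, e₂, h.nest _ _ _ _ h₁' h₂']
  | c6 a b h₁ =>
    have h₁' : a.hi < b.lo := h₁
    have h₂' := a.lo_lt_hi.trans h₁'
    obtain ⟨e₁, e₂⟩ := inv_mul a b h₂'.ne (h₂'.trans b.lo_lt_hi).ne h₁'.ne'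
    simp only [map_mul, FreeAlgebra.lift_ι_apply, smul_mul_smul_comm]
    rw [e₁, e₂, h.cross _ _ _ _ h₂' (h₁'.trans b.lo_lt_hi), ht b.lo a.hi h₁', mul_zero,
      smul_zero, sub_zero]
  | c4 a b c d h₁ h₂ h₃ hc hd =>
    have h₁' : a.lo < b.lo := h₁
    have h₂' : b.lo < a.hi := h₂
    have h₃' : a.hi < b.hi := h₃
    have c₁ : c.lo = a.lo := Fin.ext (by simp [Lam.lo, hc])
    have c₂ : c.hi = b.hi := Fin.ext (by simp [Lam.hi, hc])
    have d₁ : d.lo = b.lo := Fin.ext (by simp [Lam.lo, hd])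
    have d₂ : d.hi = a.hi := Fin.ext (by simp [Lam.hi, hd])
    obtain ⟨e₁, e₂⟩ := inv_mul a b h₁'.ne (h₁'.trans b.lo_lt_hi).ne h₂'.ne
    obtain ⟨-, e₃⟩ := inv_mul c d (by rw [c₁, d₁]; exact h₁'.ne)
      (by rw [c₁, d₂]; exact (h₁'.trans h₂').ne) (by rw [d₁, c₂]; exact (h₂'.trans h₃').ne)
    rw [c₁, c₂, d₁, d₂] at e₃
    simp only [map_mul, map_sub, map_smul, FreeAlgebra.lift_ι_apply, smul_mul_smul_comm]
    rw [c₁, c₂, d₁, d₂, e₁, e₂, e₃, h.cross _ _ _ _ h₁' h₃', mul_sub, smul_sub, mul_smul_comm,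
      smul_comm]
  | c5 a b c h₁ hc =>
    have h₁' : a.hi = b.lo := Fin.ext h₁
    have c₁ : c.lo = a.lo := Fin.ext (by simp [Lam.lo, hc])
    have c₂ : c.hi = b.hi := Fin.ext (by simp [Lam.hi, hc])
    simp only [map_mul, map_sub, map_smul, FreeAlgebra.lift_ι_apply, smul_mul_smul_comm]
    rw [c₁, c₂, h₁', h.normalizedEntry_adjacent hQ ht hu (h₁' ▸ a.lo_lt_hi) b.lo_lt_hi,
      smul_sub, smul_comm, smul_smul _ (q ^ 2 - (q ^ 2)⁻¹), smul_smul q]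
    congr 2
    field_simp

end Representation

section LinearIndependence

variable {K : Type} [Field K] {Q : K} {q : K} {N : ℕ}

theorem normalizedEntry_productMatrix_single (hQ : Q ≠ 0) {n : ℕ} {m l : Fin n} (hml : m < l)
    {a : ℕ → ℕ → ℤ} (ha : ∀ s, (m : ℕ) < s → a s m = 0) (ha' : ∀ s < (m : ℕ), a s = 0) {c : K}
    (hc : c ≠ 0) :
    ∃ d : K, d ≠ 0 ∧ normalizedEntry (productMatrix Q n n) m l (Finsupp.single a c) =
      Finsupp.single (a + (unitAt m l - unitAt m m)) d := by
  set a' := a + (unitAt m l - unitAt m m) with ha_def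
  have h₁ : ∀ s, (m : ℕ) < s → a' s m = 0 := fun s hs => by
    simp [a', ha s hs, unitAt_of_ne hs.ne']
  have h₂ : ∀ s < (m : ℕ), a' s = 0 := fun s hs => by
    simp [a', ha' s hs, unitAt_of_ne hs.ne]
  refine ⟨c * (Q * rowCoeff Q m m l a) * Q ^ a' m m, ?_, ?_⟩
  · simp only [rowCoeff, if_true, sub_zero]
    exact mul_ne_zero (mul_ne_zero hc (mul_ne_zero hQ
      (mul_ne_zero (zpow_ne_zero _ hQ) (zpow_ne_zero _ hQ)))) (zpow_ne_zero _ hQ)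
  · have e : productMatrix Q n n m m
        (Finsupp.single a' (c * (Q * rowCoeff Q m m l a) * Q ^ a' m m)) =
        productMatrix Q n n m l (Finsupp.single a c) := by
      rw [productMatrix_single Q m.2 h₁ h₂, productMatrix_single Q m.2 ha ha', rowMatrix_self,
        rowMatrix_of_lt Q m hml, weightedShift_single, weightedShift_single, add_zero, mul_assoc _ _
        (Q ^ (-_)), ← zpow_add₀ hQ, add_neg_cancel, zpow_zero, mul_one]
    rw [normalizedEntry, Module.End.mul_apply, ← e, ← Module.End.mul_apply,
      Ring.inverse_mul_cancel _ (isUnit_productMatrix hQ n m), Module.End.one_apply]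

/-- The total exponent of a word in the generators. -/
def wordShift (w : List (Lam N)) : ℕ → ℕ → ℤ :=
  (w.map fun p => unitAt p.1.1 p.1.2 - unitAt p.1.1 p.1.1).sum

theorem wordShift_of_lt {m s : ℕ} (hs : s < m) {w : List (Lam N)} (hw : ∀ p ∈ w, m ≤ p.1.1) :
    wordShift w s = 0 := by
  induction w with
  | nil => rfl
  | cons p w ih =>
    have := hw p (by simp)
    have ih := ih fun r hr => hw r (by simp [hr])
    rw [wordShift] at ih
    have hsp : s ≠ p.1.1 := by omega
    simp [wordShift, ih, unitAt_of_ne hsp]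

theorem wordShift_of_gt {m s : ℕ} (hs : m < s) (w : List (Lam N)) : wordShift w s m = 0 := by
  induction w with
  | nil => rfl
  | cons p w ih =>
    rw [wordShift] at ih
    simp only [wordShift, List.map_cons, List.sum_cons, Pi.add_apply, ih, Pi.sub_apply]
    rcases eq_or_ne s p.1.1 with rfl | hsp
    · have := p.2.2.1
      simp [unitAt_same, hs.ne, (hs.trans this).ne]
    · simp [unitAt_of_ne hsp]

theorem wordShift_apply (p : Lam N) (w : List (Lam N)) : wordShift w p.1.1 p.1.2 = w.count p := by
  induction w with
  | nil => rfl
  | cons r w ih =>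
    rw [wordShift] at ih
    simp only [wordShift, List.map_cons, List.sum_cons, Pi.add_apply, ih, Pi.sub_apply,
      List.count_cons, Nat.cast_add, beq_iff_eq, Nat.cast_ite, Nat.cast_one, Nat.cast_zero]
    rw [add_comm]
    congr 1
    have hp := p.2.2.1
    rcases eq_or_ne p.1.1 r.1.1 with h | h
    · have hr : p.1.2 ≠ r.1.1 := by omega
      have : r = p ↔ p.1.2 = r.1.2 :=
        ⟨fun e => by rw [e], fun e => Subtype.ext (Prod.ext h.symm e.symm)⟩
      simp [h, unitAt_same, hr, this]
    · have : r ≠ p := fun e => h (by rw [e])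
      simp [unitAt_of_ne h, this]

theorem wordShift_sortedWord_injective :
    Function.Injective fun α : Lam N →₀ ℕ => wordShift (sortedWord α) := by
  intro α β h
  ext p
  have := congrFun (congrFun h p.1.1) p.1.2
  simpa only [wordShift_apply, Nat.cast_inj, ← Multiset.coe_count, sortedWord, Multiset.sort_eq,
    Finsupp.count_toMultiset] using this

theorem prod_map_normalizedEntry_single (hQ : Q ≠ 0) {κ : K} (hκ : κ ≠ 0) {w : List (Lam N)}
    (hw : w.Pairwise (· ≤ ·)) :
    ∃ d : K, d ≠ 0 ∧ (w.map fun p => κ • normalizedEntry (productMatrix Q (N + 2) (N + 2))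
      p.lo p.hi).prod (Finsupp.single 0 1) = Finsupp.single (wordShift w) d := by
  induction hw with
  | nil => exact ⟨1, one_ne_zero, rfl⟩
  | @cons p w hp _ ih =>
    obtain ⟨c, hc, e⟩ := ih
    have hp' : ∀ r ∈ w, p.1.1 ≤ r.1.1 := by
      intro r hr
      rcases Prod.Lex.le_iff.1 (show toLex p.1 ≤ toLex r.1 from hp r hr) with h | h
      exacts [h.le, h.1.le]
    obtain ⟨d, hd, e'⟩ := normalizedEntry_productMatrix_single hQ p.lo_lt_hi
      (a := wordShift w) (fun s hs => wordShift_of_gt hs w) (fun s hs => wordShift_of_lt hs hp') hc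
    refine ⟨κ * d, mul_ne_zero hκ hd, ?_⟩
    rw [List.map_cons, List.prod_cons, Module.End.mul_apply, e, LinearMap.smul_apply, e',
      Finsupp.smul_single, smul_eq_mul, wordShift, wordShift, List.map_cons, List.sum_cons, add_comm]
    rfl

theorem mon_eq_sortedWord (q : K) (α : Lam N →₀ ℕ) :
    mon K q N α = ((sortedWord α).map (xg K q N)).prod :=
  prod_map_pow_eq_sortedWord α

theorem linearIndependent_mon_s2 (hq : q ≠ 0) (hΛ : q ^ 2 - (q ^ 2)⁻¹ ≠ 0) :
    LinearIndependent K (mon K q N) := by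
  have hQ : q ^ 2 ≠ 0 := pow_ne_zero 2 hq
  let rep := RingQuot.liftAlgHom K ⟨_, fun _ _ huv => JimboRel.lift_eq (N := N) hq hΛ
    (isQuantumMatrix_productMatrix hQ (N + 2)) (fun i j h => productMatrix_of_gt _ _ h)
    (isUnit_productMatrix hQ (N + 2)) huv⟩
  have hrep : ∀ p, rep (xg K q N p) = _ := fun p =>
    (RingQuot.liftAlgHom_mkAlgHom_apply K _ _ _).trans (FreeAlgebra.lift_ι_apply _ _)
  let ev := (LinearMap.applyₗ (R := K) (Finsupp.single (0 : ℕ → ℕ → ℤ) (1 : K))) ∘ₗ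
    rep.toLinearMap
  have hev : ∀ α : Lam N →₀ ℕ, ∃ d : Kˣ,
      ev (mon K q N α) = d • Finsupp.single (wordShift (sortedWord α)) (1 : K) := by
    intro α
    obtain ⟨d, hd, e⟩ := prod_map_normalizedEntry_single hQ
      (mul_ne_zero hq (inv_ne_zero hΛ)) (Multiset.pairwise_sort (Finsupp.toMultiset α) (· ≤ ·))
    refine ⟨Units.mk0 d hd, ?_⟩
    rw [Units.smul_mk0, Finsupp.smul_single, smul_eq_mul, mul_one]
    refine Eq.trans ?_ e
    rw [mon_eq_sortedWord]
    simp only [ev, LinearMap.comp_apply, AlgHom.toLinearMap_apply, map_list_prod, List.map_map,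
      Function.comp_def, hrep]
    rfl
  choose d hd using hev
  refine LinearIndependent.of_comp ev ?_
  have := ((Finsupp.linearIndependent_single_one K (ℕ → ℕ → ℤ)).comp _
    (wordShift_sortedWord_injective (N := N))).units_smul d
  convert this using 1
  funext α
  exact hd α

end LinearIndependence

section Spanning

variable {K : Type} [Field K] {q : K} {N : ℕ}

/-- A strictly concave weight on the generators, for which all correction terms in the
Jimbo relations are smaller. -/
def Lam.weight {N : ℕ} (p : Lam N) : ℕ := (p.1.2 - p.1.1) * (N + 1 - (p.1.2 - p.1.1))

theorem Lam.weight_lt_of_adjacent {a b c : Lam N} (h : a.1.2 = b.1.1)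
    (hc : c.1 = (a.1.1, b.1.2)) : c.weight < a.weight + b.weight := by
  have hb := b.2
  obtain ⟨u, hu⟩ := Nat.exists_eq_add_of_lt a.2.2.1
  obtain ⟨v, hv⟩ := Nat.exists_eq_add_of_lt b.2.2.1
  have ha := a.2.1
  obtain ⟨w, hw⟩ : ∃ w, N + 1 = (u + 1) + (v + 1) + w := Nat.exists_eq_add_of_le (by omega)
  have e₁ : b.1.2 - a.1.1 = (u + 1) + (v + 1) := by omega
  have e₂ : a.1.2 - a.1.1 = u + 1 := by omega
  have e₃ : b.1.2 - b.1.1 = v + 1 := by omega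
  have e₄ : N + 1 - (u + 1 + (v + 1)) = w := by omega
  have e₅ : N + 1 - (u + 1) = v + 1 + w := by omega
  have e₆ : N + 1 - (v + 1) = u + 1 + w := by omega
  simp only [Lam.weight, hc, e₁, e₂, e₃, e₄, e₅, e₆]
  nlinarith [Nat.zero_le (u * v)]

theorem Lam.weight_add_lt_of_crossing {a b c d : Lam N} (h₁ : a.1.1 < b.1.1) (h₂ : b.1.1 < a.1.2)
    (h₃ : a.1.2 < b.1.2) (hc : c.1 = (a.1.1, b.1.2)) (hd : d.1 = (b.1.1, a.1.2)) :
    c.weight + d.weight < a.weight + b.weight := by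
  have hb := b.2
  have ha := a.2.1
  obtain ⟨u, hu⟩ := Nat.exists_eq_add_of_lt h₁
  obtain ⟨v, hv⟩ := Nat.exists_eq_add_of_lt h₂
  obtain ⟨t, ht⟩ := Nat.exists_eq_add_of_lt h₃
  obtain ⟨w, hw⟩ : ∃ w, N + 1 = (u + 1) + (v + 1) + (t + 1) + w :=
    Nat.exists_eq_add_of_le (by omega)
  have e₁ : b.1.2 - a.1.1 = (u + 1) + (v + 1) + (t + 1) := by omega
  have e₂ : a.1.2 - a.1.1 = (u + 1) + (v + 1) := by omega
  have e₃ : b.1.2 - b.1.1 = (v + 1) + (t + 1) := by omega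
  have e₄ : a.1.2 - b.1.1 = v + 1 := by omega
  have e₅ : N + 1 - ((u + 1) + (v + 1) + (t + 1)) = w := by omega
  have e₆ : N + 1 - ((u + 1) + (v + 1)) = t + 1 + w := by omega
  have e₇ : N + 1 - ((v + 1) + (t + 1)) = u + 1 + w := by omega
  have e₈ : N + 1 - (v + 1) = u + 1 + (t + 1) + w := by omega
  simp only [Lam.weight, hc, hd, e₁, e₂, e₃, e₄, e₅, e₆, e₇, e₈]
  nlinarith [Nat.zero_le (u * t)]

theorem xg_mul_eq {a b : Lam N} {v : FreeAlgebra K (Lam N)}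
    (h : JimboRel K q N (FreeAlgebra.ι K b * FreeAlgebra.ι K a) v) :
    xg K q N b * xg K q N a = RingQuot.mkAlgHom K (JimboRel K q N) v := by
  rw [xg, xg, ← map_mul]
  exact RingQuot.mkAlgHom_rel K h

theorem skewCommutes_xg (hq : q ≠ 0) : SkewCommutes K (xg K q N) Lam.weight := by
  have hQ : q ^ 2 ≠ 0 := pow_ne_zero 2 hq
  refine SkewCommutes.of_lt fun a b hab => ?_
  have ha := a.2
  have hb := b.2
  have of_rel : ∀ c : K, c ≠ 0 → JimboRel K q N (FreeAlgebra.ι K b * FreeAlgebra.ι K a)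
      (c • (FreeAlgebra.ι K a * FreeAlgebra.ι K b)) → ∃ c : K, c ≠ 0 ∧
      xg K q N b * xg K q N a - c • (xg K q N a * xg K q N b) ∈
        wordSpan K (xg K q N) Lam.weight (a.weight + b.weight) := by
    intro c hc h
    refine ⟨c, hc, ?_⟩
    rw [xg_mul_eq h, map_smul, map_mul]
    simp [xg]
  rcases Prod.Lex.lt_iff.1 (show toLex a.1 < toLex b.1 from hab) with h | ⟨h, h'⟩
  · replace h : a.1.1 < b.1.1 := h
    rcases lt_trichotomy a.1.2 b.1.1 with h₁ | h₁ | h₁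
    · refine of_rel 1 one_ne_zero ?_
      rw [one_smul]
      exact .c6 a b h₁
    · let c : Lam N := ⟨(a.1.1, b.1.2), ha.1, by simp only; omega, hb.2.2⟩
      refine ⟨q ^ 2, hQ, ?_⟩
      rw [xg_mul_eq (.c5 a b c h₁ rfl), map_sub, map_smul, map_smul, map_mul]
      simp only [xg]
      rw [sub_right_comm, sub_self, zero_sub]
      refine neg_mem (Submodule.smul_mem _ _ ?_)
      simpa [xg] using word_mem_wordSpan (K := K) (x := xg K q N) (w := [c])
        (by simpa using Lam.weight_lt_of_adjacent (c := c) h₁ rfl)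
    · rcases lt_trichotomy a.1.2 b.1.2 with h₂ | h₂ | h₂
      · let c : Lam N := ⟨(a.1.1, b.1.2), ha.1, by simp only; omega, hb.2.2⟩
        let d : Lam N := ⟨(b.1.1, a.1.2), hb.1, h₁, ha.2.2⟩
        refine ⟨1, one_ne_zero, ?_⟩
        rw [xg_mul_eq (.c4 a b c d h h₁ h₂ rfl rfl), map_sub, map_smul, map_mul, map_mul]
        simp only [xg, one_smul]
        rw [sub_right_comm, sub_self, zero_sub]
        refine neg_mem (Submodule.smul_mem _ _ ?_)
        simpa [xg] using word_mem_wordSpan (K := K) (x := xg K q N) (w := [c, d])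
          (by simpa using Lam.weight_add_lt_of_crossing (c := c) (d := d) h h₁ h₂ rfl rfl)
      · exact of_rel _ (inv_ne_zero hQ) (.c3 a b h h₂)
      · refine of_rel 1 one_ne_zero ?_
        rw [one_smul]
        exact .c2 a b h h₂
  · exact of_rel _ (inv_ne_zero hQ) (.c1 a b h h')

theorem span_mon (hq : q ≠ 0) : Submodule.span K (Set.range (mon K q N)) = ⊤ := by
  have hspan : ∀ w : List (Lam N),
      (w.map (xg K q N)).prod ∈ Submodule.span K (Set.range (mon K q N)) := by
    intro w
    have := (skewCommutes_xg (N := N) hq).word_mem_span w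
    rwa [show (fun α => ((sortedWord α).map (xg K q N)).prod) = mon K q N from
      funext fun α => (mon_eq_sortedWord q α).symm] at this
  have hle : Submodule.span K (Set.range fun w : List (Lam N) => (w.map (xg K q N)).prod) ≤
      Submodule.span K (Set.range (mon K q N)) := by
    rw [Submodule.span_le]
    rintro _ ⟨w, rfl⟩
    exact hspan w
  refine eq_top_iff.2 (le_trans ?_ hle)
  rintro y -
  obtain ⟨z, rfl⟩ := RingQuot.mkAlgHom_surjective K (JimboRel K q N) y
  induction z using FreeAlgebra.induction with
  | grade0 r =>
    rw [AlgHom.commutes, Algebra.algebraMap_eq_smul_one]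
    exact Submodule.smul_mem _ _ (Submodule.subset_span ⟨[], rfl⟩)
  | grade1 p => exact Submodule.subset_span ⟨[p], by simp [xg]⟩
  | mul u v hu hv =>
    rw [map_mul]
    have := Submodule.mul_mem_mul hu hv
    rw [Submodule.span_mul_span] at this
    refine Submodule.span_mono ?_ this
    rintro _ ⟨_, ⟨w, rfl⟩, _, ⟨w', rfl⟩, rfl⟩
    exact ⟨w ++ w', by simp⟩
  | add u v hu hv =>
    rw [map_add]
    exact add_mem hu hv

end Spanning

section Tensor

variable {K : Type} [Field K] {q : K} {N : ℕ}

instance inst_s2 (N : ℕ) : Finite (Lam N) :=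
  Finite.of_injective (fun p : Lam N => (p.lo, p.hi)) fun a b h => by
    simp only [Lam.lo, Lam.hi, Prod.mk.injEq, Fin.mk.injEq] at h
    exact Subtype.ext (Prod.ext h.1 h.2)

theorem mon_mul_mon (hq : q ≠ 0) (α β : Lam N →₀ ℕ) :
    ∃ c : K, c ≠ 0 ∧ ∃ f ∈ Submodule.span K (mon K q N '' {γ |
        Finsupp.weight Lam.weight γ < Finsupp.weight Lam.weight (α + β)}),
      mon K q N α * mon K q N β = c • mon K q N (α + β) + f := by
  obtain ⟨c, hc, f, hf, h⟩ := (skewCommutes_xg (N := N) hq).sortedWord_mul α β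
  simp only [mon_eq_sortedWord]
  refine ⟨c, hc, f, Submodule.span_mono ?_ hf, h⟩
  rintro _ ⟨γ, hγ, rfl⟩
  exact ⟨γ, hγ, rfl⟩

theorem tmul_mem_span_of_mem_span {K A B : Type*} [CommRing K] [AddCommGroup A] [AddCommGroup B]
    [Module K A] [Module K B] {s : Set A} {t : Set B} {u : Set (A ⊗[K] B)}
    (h : ∀ a ∈ s, ∀ b ∈ t, a ⊗ₜ[K] b ∈ u) {a : A} {b : B} (ha : a ∈ Submodule.span K s)
    (hb : b ∈ Submodule.span K t) : a ⊗ₜ[K] b ∈ Submodule.span K u := by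
  have := Submodule.apply_mem_map₂ (TensorProduct.mk K A B) ha hb
  rw [Submodule.map₂_span_span] at this
  refine Submodule.span_mono ?_ this
  rintro _ ⟨a, ha, b, hb, rfl⟩
  exact h a ha b hb

end Tensor

/-- If q^8 ≠ 1 then R = U_q^+(A_N) ⊗_K U_q^-(A_N) (the (−)-part being presented
by the same Jimbo relations, hence another copy of U_q^+(A_N)) is a solvable polynomial
algebra: the elements m_α ⊗ m'_β form a K-basis, and there is a monomial order ⊑ on pairs
such that (m_{α₁} ⊗ m'_{β₁})(m_{α₂} ⊗ m'_{β₂}) = c • (m_{α₁+α₂} ⊗ m'_{β₁+β₂}) + f with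
c ≠ 0 and f in the span of the m_γ ⊗ m'_δ with (γ,δ) ⊏ (α₁+α₂, β₁+β₂). -/
theorem tensor_solvablePolynomialAlgebra (K : Type) [Field K] (q : K) (hq0 : q ≠ 0)
    (hq8 : q ^ 8 ≠ 1) (N : ℕ) (hN : 1 ≤ N) :
    LinearIndependent K (fun p : (Lam N →₀ ℕ) × (Lam N →₀ ℕ) =>
      (mon K q N p.1 ⊗ₜ[K] mon K q N p.2 : UqPlus K q N ⊗[K] UqPlus K q N)) ∧
    Submodule.span K (Set.range (fun p : (Lam N →₀ ℕ) × (Lam N →₀ ℕ) =>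
      (mon K q N p.1 ⊗ₜ[K] mon K q N p.2 : UqPlus K q N ⊗[K] UqPlus K q N))) = ⊤ ∧
    ∃ r : ((Lam N →₀ ℕ) × (Lam N →₀ ℕ)) → ((Lam N →₀ ℕ) × (Lam N →₀ ℕ)) → Prop,
      WellFounded r ∧ (∀ p, ¬ r p p) ∧ (∀ p₁ p₂ p₃, r p₁ p₂ → r p₂ p₃ → r p₁ p₃) ∧
      (∀ p₁ p₂, p₁ ≠ p₂ → r p₁ p₂ ∨ r p₂ p₁) ∧
      (∀ p, p ≠ (0, 0) → r (0, 0) p) ∧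
      (∀ p₁ p₂ γ δ, r p₁ p₂ → r (p₁.1 + γ, p₁.2 + δ) (p₂.1 + γ, p₂.2 + δ)) ∧
      ∀ α₁ β₁ α₂ β₂ : Lam N →₀ ℕ,
        ∃ (c : K) (f : UqPlus K q N ⊗[K] UqPlus K q N), c ≠ 0 ∧
          f ∈ Submodule.span K {m : UqPlus K q N ⊗[K] UqPlus K q N |
            ∃ γ δ, r (γ, δ) (α₁ + α₂, β₁ + β₂) ∧ m = mon K q N γ ⊗ₜ[K] mon K q N δ} ∧
          (mon K q N α₁ ⊗ₜ[K] mon K q N β₁) * (mon K q N α₂ ⊗ₜ[K] mon K q N β₂)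
            = c • (mon K q N (α₁ + α₂) ⊗ₜ[K] mon K q N (β₁ + β₂)) + f := by
  have hΛ : q ^ 2 - (q ^ 2)⁻¹ ≠ 0 := by
    intro h
    have h4 : q ^ 2 * q ^ 2 = 1 := by
      rw [sub_eq_zero] at h
      nth_rw 1 [h]
      exact inv_mul_cancel₀ (pow_ne_zero 2 hq0)
    exact hq8 (by linear_combination (q ^ 4 + 1) * h4)
  let b := Module.Basis.mk (linearIndependent_mon_s2 (N := N) hq0 hΛ) (span_mon hq0).ge
  have hb : ∀ p : (Lam N →₀ ℕ) × (Lam N →₀ ℕ),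
      (b.tensorProduct b) p = mon K q N p.1 ⊗ₜ[K] mon K q N p.2 := by
    intro p
    rw [Module.Basis.tensorProduct_apply', Module.Basis.mk_apply, Module.Basis.mk_apply]
  simp only [← hb]
  obtain ⟨r, h₁, h₂, h₃, h₄, h₅, h₆, hr⟩ :=
    exists_monomialOrder_of_weight (Finsupp.weight (Lam.weight (N := N)))
  refine ⟨(b.tensorProduct b).linearIndependent, (b.tensorProduct b).span_eq,
    r, h₁, h₂, h₃, h₄, h₅, h₆, fun α₁ β₁ α₂ β₂ => ?_⟩
  obtain ⟨c, hc, f, hf, e⟩ := mon_mul_mon hq0 α₁ α₂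
  obtain ⟨d, hd, g, hg, e'⟩ := mon_mul_mon hq0 β₁ β₂
  have hα : mon K q N (α₁ + α₂) ∈ Submodule.span K (mon K q N '' {α₁ + α₂}) :=
    Submodule.subset_span ⟨_, rfl, rfl⟩
  have hβ : mon K q N (β₁ + β₂) ∈ Submodule.span K (mon K q N '' {β₁ + β₂}) :=
    Submodule.subset_span ⟨_, rfl, rfl⟩
  refine ⟨c * d, (c • mon K q N (α₁ + α₂)) ⊗ₜ g + f ⊗ₜ (d • mon K q N (β₁ + β₂)) + f ⊗ₜ g,
    mul_ne_zero hc hd, add_mem (add_mem ?_ ?_) ?_, ?_⟩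
  · refine tmul_mem_span_of_mem_span ?_ (Submodule.smul_mem _ _ hα) hg
    rintro _ ⟨γ, rfl, rfl⟩ _ ⟨δ, hδ, rfl⟩
    exact ⟨_, δ, hr _ _ (Nat.add_lt_add_left hδ _), rfl⟩
  · refine tmul_mem_span_of_mem_span ?_ hf (Submodule.smul_mem _ _ hβ)
    rintro _ ⟨γ, hγ, rfl⟩ _ ⟨δ, rfl, rfl⟩
    exact ⟨γ, _, hr _ _ (Nat.add_lt_add_right hγ _), rfl⟩
  · refine tmul_mem_span_of_mem_span ?_ hf hg
    rintro _ ⟨γ, hγ, rfl⟩ _ ⟨δ, hδ, rfl⟩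
    exact ⟨γ, δ, hr _ _ (Nat.add_lt_add hγ hδ), rfl⟩
  · rw [Algebra.TensorProduct.tmul_mul_tmul, e, e']
    simp only [TensorProduct.add_tmul, TensorProduct.tmul_add, ← TensorProduct.smul_tmul',
      TensorProduct.tmul_smul]
    module
end
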